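/- arXiv:1406.1950 — 4 statements merged into one kernel-verified Lean document; each statement's English description precedes it below -/
import Mathlib

section
/- Let $\mathcal P = \{P^j\}_{j=1}^d$ with $M := \sup_{i \in \mathbb N, 1 \le j \le d} p^j_i < \infty$, let $\Psi$ be a complex-valued additive function on the $\mathcal P$-adic parallelepipeds, fix $I_0 \in \Lambda^d$, and let $\{h_m\}_{m=1}^\infty$ be a sequence of functions on $I_0$ satisfying conditions (h1)–(h3). If $\lim_{m \to \infty} \int_{\{x \in I_0 : \Psi^*(x) > h_m(x)\}} h_m(x)\,dx = 0$ and $\Psi'(x)$ exists almost everywhere on $I_0$, then for every $I \in \Lambda^d$ with $I \subset I_0$ one has $\Psi(I) = \lim_{m \to \infty} \int_I [\Psi'(x)]_{h_m(x)}\,dx$. -/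
open MeasureTheory Filter Topology

noncomputable section

/-- `mseq p k = ∏_{i<k} p i`, i.e. the product `m_k = p_1 ⋯ p_k` generated by the
sequence `p` (indexed from `0` in Lean). -/
def mseq (p : ℕ → ℕ) (k : ℕ) : ℕ := ∏ i ∈ Finset.range k, p i

/-- The `𝒫`-adic parallelepiped of rank `k` with corner index `n`, i.e.
`[n₁/m¹ₖ, (n₁+1)/m¹ₖ] × ⋯ × [n_d/mᵈₖ, (n_d+1)/mᵈₖ]`. -/
def cell {d : ℕ} (p : Fin d → ℕ → ℕ) (k : ℕ) (n : Fin d → ℤ) : Set (Fin d → ℝ) :=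
  Set.univ.pi fun j =>
    Set.Icc ((n j : ℝ) / (mseq (p j) k : ℝ)) (((n j : ℝ) + 1) / (mseq (p j) k : ℝ))

/-- `Λᵈ`, the collection of all `𝒫`-adic parallelepipeds (of all ranks). -/
def Lambda {d : ℕ} (p : Fin d → ℕ → ℕ) : Set (Set (Fin d → ℝ)) :=
  {I | ∃ k n, I = cell p k n}

/-- `Ψ` is additive on the `𝒫`-adic parallelepipeds: whenever `I ∈ Λᵈ` is the union of
finitely many members of `Λᵈ` with pairwise disjoint interiors, `Ψ I` is the sum of their
values. -/
def IsAdditive {d : ℕ} (p : Fin d → ℕ → ℕ) (Ψ : Set (Fin d → ℝ) → ℂ) : Prop :=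
  ∀ (I : Set (Fin d → ℝ)) (s : ℕ) (J : Fin s → Set (Fin d → ℝ)),
    I ∈ Lambda p → (∀ i, J i ∈ Lambda p) →
    (∀ i j, i ≠ j → Disjoint (interior (J i)) (interior (J j))) →
    (⋃ i, J i) = I → Ψ I = ∑ i, Ψ (J i)

/-- The `𝒫`-adic parallelepiped of rank `k` containing `x`; for a `𝒫`-irrational point `x`
it is the unique member of `Λᵈ_k` containing `x`. -/
def cellAt {d : ℕ} (p : Fin d → ℕ → ℕ) (k : ℕ) (x : Fin d → ℝ) : Set (Fin d → ℝ) :=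
  cell p k fun j => ⌊x j * (mseq (p j) k : ℝ)⌋

/-- The set `{x | Ψ*(x) > lam x}`, where `Ψ*(x) = sup {‖Ψ I‖/μ(I) | I ∈ Λᵈ, x ∈ I}` is the
majorant of `Ψ`. -/
def starGt {d : ℕ} (p : Fin d → ℕ → ℕ) (Ψ : Set (Fin d → ℝ) → ℂ)
    (lam : (Fin d → ℝ) → ℝ) : Set (Fin d → ℝ) :=
  {x | ∃ I ∈ Lambda p, x ∈ I ∧ lam x < ‖Ψ I‖ / (volume I).toReal}

/-- Truncation of `f` by the function `lam`: `[f(x)]_{lam(x)}`. -/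
def trunc {α : Type*} (f : α → ℂ) (lam : α → ℝ) (x : α) : ℂ :=
  if ‖f x‖ ≤ lam x then f x else 0

/-- Conditions (h1)–(h3) on the sequence of functions `h m : I₀ → ℝ`:
(h1) `0 ≤ h 1 ≤ h 2 ≤ ⋯` and `h m x → ∞` on `I₀`; (h2)–(h3) there are a constant `C > 0`
and, for each `m`, parallelepipeds `J 1, …, J s ∈ Λᵈ` with pairwise disjoint interiors and
union `I₀` on each of which `sup h m ≤ C * inf h m`, and with `inf_{m,i} ∫_{J i} h m > 0`. -/
def HConds {d : ℕ} (p : Fin d → ℕ → ℕ) (I0 : Set (Fin d → ℝ))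
    (h : ℕ → (Fin d → ℝ) → ℝ) : Prop :=
  (∀ x ∈ I0, (∀ m, 0 ≤ h m x) ∧ (Monotone fun m => h m x) ∧
      Tendsto (fun m => h m x) atTop atTop) ∧
  ∃ C > (0 : ℝ), ∃ ε > (0 : ℝ), ∀ m : ℕ, ∃ (s : ℕ) (J : Fin s → Set (Fin d → ℝ)),
    (∀ i, J i ∈ Lambda p) ∧
    (∀ i j, i ≠ j → Disjoint (interior (J i)) (interior (J j))) ∧
    (⋃ i, J i) = I0 ∧
    (∀ i, ∀ x ∈ J i, ∀ y ∈ J i, h m x ≤ C * h m y) ∧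
    (∀ i, ε ≤ ∫ x in J i, h m x)

/-- The index of the half-open `𝒫`-adic parallelepiped of rank `k` containing `x`. -/
def cellIdx {d : ℕ} (p : Fin d → ℕ → ℕ) (k : ℕ) (x : Fin d → ℝ) : Fin d → ℤ :=
  fun j => ⌊x j * (mseq (p j) k : ℝ)⌋

/-- The half-open `𝒫`-adic parallelepiped of rank `k` with index `n`. -/
def halfCell {d : ℕ} (p : Fin d → ℕ → ℕ) (k : ℕ) (n : Fin d → ℤ) : Set (Fin d → ℝ) :=
  cellIdx p k ⁻¹' {n}

/-- The indices of the parallelepipeds of rank `k + 1` contained in the one of rank `k` with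
index `n`. -/
def childIdx {d : ℕ} (p : Fin d → ℕ → ℕ) (k : ℕ) (n : Fin d → ℤ) : Finset (Fin d → ℤ) :=
  Fintype.piFinset fun j => Finset.Ico ((p j k : ℤ) * n j) ((p j k : ℤ) * (n j + 1))

section Cells

variable {d : ℕ} {p : Fin d → ℕ → ℕ}

lemma mseq_pos (hp : ∀ j i, 0 < p j i) (j : Fin d) (k : ℕ) : 0 < mseq (p j) k :=
  Finset.prod_pos fun i _ => hp j i

lemma mseq_succ (q : ℕ → ℕ) (k : ℕ) : mseq q (k + 1) = mseq q k * q k :=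
  Finset.prod_range_succ _ _

lemma cellAt_eq (k : ℕ) (x : Fin d → ℝ) : cellAt p k x = cell p k (cellIdx p k x) := rfl

lemma cellIdx_succ (hp : ∀ j i, 0 < p j i) (k : ℕ) (x : Fin d → ℝ) (j : Fin d) :
    cellIdx p (k + 1) x j / (p j k : ℤ) = cellIdx p k x j := by
  have := Int.mul_natCast_floor_div_cancel (hp j k).ne' (x j * (mseq (p j) k : ℝ))
  simp only [cellIdx, mseq_succ, Nat.cast_mul]
  rw [← this, mul_assoc]

lemma cellIdx_eq_of_succ (hp : ∀ j i, 0 < p j i) {k : ℕ} {x y : Fin d → ℝ}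
    (hxy : cellIdx p (k + 1) x = cellIdx p (k + 1) y) : cellIdx p k x = cellIdx p k y := by
  ext j
  rw [← cellIdx_succ hp k x, ← cellIdx_succ hp k y, hxy]

lemma cellIdx_eq_of_le (hp : ∀ j i, 0 < p j i) {k l : ℕ} (hkl : k ≤ l) {x y : Fin d → ℝ}
    (hxy : cellIdx p l x = cellIdx p l y) : cellIdx p k x = cellIdx p k y := by
  induction l, hkl using Nat.le_induction with
  | base => exact hxy
  | succ l _ ih => exact ih (cellIdx_eq_of_succ hp hxy)

lemma mem_childIdx (hp : ∀ j i, 0 < p j i) {k : ℕ} {n n' : Fin d → ℤ} :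
    n' ∈ childIdx p k n ↔ ∀ j, n' j / (p j k : ℤ) = n j := by
  simp only [childIdx, Fintype.mem_piFinset, Finset.mem_Ico]
  refine forall_congr' fun j => ?_
  have h0 : (0 : ℤ) < p j k := by exact_mod_cast hp j k
  rw [Int.ediv_eq_iff_of_pos h0]
  constructor <;> rintro ⟨h1, h2⟩ <;> constructor <;> nlinarith

lemma cellIdx_mem_childIdx (hp : ∀ j i, 0 < p j i) (k : ℕ) (x : Fin d → ℝ) :
    cellIdx p (k + 1) x ∈ childIdx p k (cellIdx p k x) :=
  (mem_childIdx hp).2 (cellIdx_succ hp k x)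

lemma halfCell_eq_pi (hp : ∀ j i, 0 < p j i) (k : ℕ) (n : Fin d → ℤ) :
    halfCell p k n = Set.univ.pi fun j =>
      Set.Ico ((n j : ℝ) / (mseq (p j) k : ℝ)) (((n j : ℝ) + 1) / (mseq (p j) k : ℝ)) := by
  ext x
  simp only [halfCell, Set.mem_preimage, Set.mem_singleton_iff, funext_iff, cellIdx,
    Set.mem_univ_pi, Set.mem_Ico, Int.floor_eq_iff]
  refine forall_congr' fun j => ?_
  have h0 : (0 : ℝ) < mseq (p j) k := by exact_mod_cast mseq_pos hp j k
  rw [div_le_iff₀ h0, lt_div_iff₀ h0]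

lemma halfCell_subset_cell (hp : ∀ j i, 0 < p j i) (k : ℕ) (n : Fin d → ℤ) :
    halfCell p k n ⊆ cell p k n := by
  rw [halfCell_eq_pi hp]
  exact Set.pi_mono fun j _ => Set.Ico_subset_Icc_self

lemma mem_cellAt (hp : ∀ j i, 0 < p j i) (k : ℕ) (x : Fin d → ℝ) : x ∈ cellAt p k x :=
  halfCell_subset_cell hp k _ rfl

lemma div_mseq_lt (hp : ∀ j i, 0 < p j i) (k : ℕ) (n : Fin d → ℤ) (j : Fin d) :
    (n j : ℝ) / (mseq (p j) k : ℝ) < ((n j : ℝ) + 1) / (mseq (p j) k : ℝ) := by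
  have h0 : (0 : ℝ) < mseq (p j) k := by exact_mod_cast mseq_pos hp j k
  gcongr
  linarith

lemma closure_halfCell (hp : ∀ j i, 0 < p j i) (k : ℕ) (n : Fin d → ℤ) :
    closure (halfCell p k n) = cell p k n := by
  rw [halfCell_eq_pi hp, closure_pi_set, cell]
  congr 1
  ext1 j
  exact closure_Ico (div_mseq_lt hp k n j).ne

lemma isClosed_cell (k : ℕ) (n : Fin d → ℤ) : IsClosed (cell p k n) :=
  isClosed_set_pi fun _ _ => isClosed_Icc

lemma measurableSet_cell (k : ℕ) (n : Fin d → ℤ) : MeasurableSet (cell p k n) :=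
  (isClosed_cell k n).measurableSet

lemma interior_cell (k : ℕ) (n : Fin d → ℤ) :
    interior (cell p k n) = Set.univ.pi fun j =>
      Set.Ioo ((n j : ℝ) / (mseq (p j) k : ℝ)) (((n j : ℝ) + 1) / (mseq (p j) k : ℝ)) := by
  rw [cell, interior_pi_set Set.finite_univ]
  simp only [interior_Icc]

lemma closure_interior_cell (hp : ∀ j i, 0 < p j i) (k : ℕ) (n : Fin d → ℤ) :
    closure (interior (cell p k n)) = cell p k n := by
  rw [interior_cell, closure_pi_set, cell]
  congr 1
  ext1 j
  exact closure_Ioo (div_mseq_lt hp k n j).ne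

lemma cell_nonempty (hp : ∀ j i, 0 < p j i) (k : ℕ) (n : Fin d → ℤ) : (cell p k n).Nonempty :=
  Set.univ_pi_nonempty_iff.2 fun j => Set.nonempty_Icc.2 (div_mseq_lt hp k n j).le

lemma interior_cell_ae_eq (k : ℕ) (n : Fin d → ℤ) :
    interior (cell p k n) =ᵐ[volume] cell p k n :=
  interior_ae_eq_of_null_frontier
    ((convex_pi fun _ _ => convex_Icc _ _).addHaar_frontier volume)

lemma halfCell_ae_eq (hp : ∀ j i, 0 < p j i) (k : ℕ) (n : Fin d → ℤ) :
    halfCell p k n =ᵐ[volume] cell p k n := by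
  rw [halfCell_eq_pi hp, cell, Set.pi_univ_Icc, volume_pi]
  exact Measure.univ_pi_Ico_ae_eq_Icc

lemma volume_cell (k : ℕ) (n : Fin d → ℤ) :
    volume (cell p k n) = ∏ j, ENNReal.ofReal (1 / (mseq (p j) k : ℝ)) := by
  rw [cell, volume_pi_pi]
  simp only [Real.volume_Icc]
  congr! 2
  ring

lemma volume_cell_ne_top (k : ℕ) (n : Fin d → ℤ) : volume (cell p k n) ≠ ⊤ := by
  rw [volume_cell]
  exact ENNReal.prod_ne_top fun _ _ => ENNReal.ofReal_ne_top

lemma volume_cell_ne_zero (hp : ∀ j i, 0 < p j i) (k : ℕ) (n : Fin d → ℤ) :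
    volume (cell p k n) ≠ 0 := by
  rw [volume_cell]
  refine Finset.prod_ne_zero_iff.2 fun j _ => ?_
  simpa using (mseq_pos hp j k).ne'

lemma volume_cell_toReal_pos (hp : ∀ j i, 0 < p j i) (k : ℕ) (n : Fin d → ℤ) :
    0 < (volume (cell p k n)).toReal :=
  ENNReal.toReal_pos (volume_cell_ne_zero hp k n) (volume_cell_ne_top k n)

lemma volume_cell_le_mul (hp : ∀ j i, 0 < p j i) {M : ℕ} (hM : ∀ j i, p j i ≤ M)
    (k : ℕ) (n n' : Fin d → ℤ) :
    volume (cell p k n) ≤ (M : ENNReal) ^ d * volume (cell p (k + 1) n') := by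
  have h1 : (M : ENNReal) ^ d = ∏ _j : Fin d, (M : ENNReal) := by simp
  rw [volume_cell, volume_cell, h1, ← Finset.prod_mul_distrib]
  refine Finset.prod_le_prod' fun j _ => ?_
  have h0 : (0 : ℝ) < mseq (p j) k := by exact_mod_cast mseq_pos hp j k
  have h2 : (0 : ℝ) < p j k := by exact_mod_cast hp j k
  have h3 : (p j k : ℝ) ≤ M := by exact_mod_cast hM j k
  rw [← ENNReal.ofReal_natCast, ← ENNReal.ofReal_mul (by positivity), mseq_succ, Nat.cast_mul]
  apply ENNReal.ofReal_le_ofReal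
  rw [mul_one_div, div_le_div_iff₀ h0 (by positivity)]
  nlinarith

lemma measurable_cellIdx (k : ℕ) : Measurable (cellIdx p k) :=
  measurable_pi_lambda _ fun j => Int.measurable_floor.comp ((measurable_pi_apply j).mul_const _)

lemma measurableSet_halfCell (k : ℕ) (n : Fin d → ℤ) : MeasurableSet (halfCell p k n) :=
  measurable_cellIdx k (measurableSet_singleton n)

lemma disjoint_halfCell (k : ℕ) {n n' : Fin d → ℤ} (hn : n ≠ n') :
    Disjoint (halfCell p k n) (halfCell p k n') :=
  Disjoint.preimage _ (by simpa using hn)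

lemma cellIdx_of_mem_interior (hp : ∀ j i, 0 < p j i) {k : ℕ} {n : Fin d → ℤ} {x : Fin d → ℝ}
    (hx : x ∈ interior (cell p k n)) : cellIdx p k x = n := by
  have : x ∈ halfCell p k n := by
    rw [interior_cell] at hx
    rw [halfCell_eq_pi hp]
    exact Set.pi_mono (fun j _ => Set.Ioo_subset_Ico_self) hx
  exact this

lemma disjoint_interior_cell (hp : ∀ j i, 0 < p j i) (k : ℕ) {n n' : Fin d → ℤ} (hn : n ≠ n') :
    Disjoint (interior (cell p k n)) (interior (cell p k n')) :=
  Set.disjoint_left.2 fun _ hx hx' =>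
    hn ((cellIdx_of_mem_interior hp hx).symm.trans (cellIdx_of_mem_interior hp hx'))

lemma halfCell_eq_biUnion (hp : ∀ j i, 0 < p j i) (k : ℕ) (n : Fin d → ℤ) :
    halfCell p k n = ⋃ n' ∈ childIdx p k n, halfCell p (k + 1) n' := by
  ext x
  simp only [halfCell, Set.mem_preimage, Set.mem_singleton_iff, Set.mem_iUnion, exists_prop,
    exists_eq_right']
  rw [mem_childIdx hp, funext_iff]
  simp only [cellIdx_succ hp]

lemma cell_eq_biUnion (hp : ∀ j i, 0 < p j i) (k : ℕ) (n : Fin d → ℤ) :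
    cell p k n = ⋃ n' ∈ childIdx p k n, cell p (k + 1) n' := by
  rw [← closure_halfCell hp, halfCell_eq_biUnion hp, Finset.closure_biUnion]
  simp only [closure_halfCell hp]

/-- Of two parallelepipeds with intersecting interiors, the one of larger rank is contained in the
other. -/
lemma cell_subset_of_interior_inter (hp : ∀ j i, 0 < p j i) {k l : ℕ} (hkl : k ≤ l)
    {n n' : Fin d → ℤ} {x : Fin d → ℝ} (hx : x ∈ interior (cell p k n))
    (hx' : x ∈ interior (cell p l n')) : cell p l n' ⊆ cell p k n := by
  have h1 := cellIdx_of_mem_interior hp hx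
  have h2 := cellIdx_of_mem_interior hp hx'
  rw [← closure_halfCell hp l, ← closure_halfCell hp k]
  refine closure_mono fun y hy => ?_
  have hy' : cellIdx p l y = n' := hy
  exact (cellIdx_eq_of_le hp hkl (hy'.trans h2.symm)).trans h1

lemma subset_or_subset_of_interior_inter (hp : ∀ j i, 0 < p j i) {I J : Set (Fin d → ℝ)}
    (hI : I ∈ Lambda p) (hJ : J ∈ Lambda p) {x : Fin d → ℝ} (hx : x ∈ interior I)
    (hx' : x ∈ interior J) : I ⊆ J ∨ J ⊆ I := by
  obtain ⟨k, n, rfl⟩ := hI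
  obtain ⟨l, n', rfl⟩ := hJ
  rcases le_total k l with hkl | hkl
  · exact Or.inr (cell_subset_of_interior_inter hp hkl hx hx')
  · exact Or.inl (cell_subset_of_interior_inter hp hkl hx' hx)

lemma finite_cellIdx_image (k l : ℕ) (n : Fin d → ℤ) : (cellIdx p l '' cell p k n).Finite := by
  refine (Set.finite_Icc
    (fun j => ⌊(n j : ℝ) / (mseq (p j) k : ℝ) * (mseq (p j) l : ℝ)⌋)
    (fun j => ⌊((n j : ℝ) + 1) / (mseq (p j) k : ℝ) * (mseq (p j) l : ℝ)⌋)).subset ?_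
  rintro _ ⟨x, hx, rfl⟩
  have hx' := fun j => Set.mem_univ_pi.1 hx j
  refine ⟨fun j => ?_, fun j => ?_⟩
  · exact Int.floor_le_floor (mul_le_mul_of_nonneg_right (hx' j).1 (Nat.cast_nonneg _))
  · exact Int.floor_le_floor (mul_le_mul_of_nonneg_right (hx' j).2 (Nat.cast_nonneg _))

lemma IsAdditive.eq_sum_finset {Ψ : Set (Fin d → ℝ) → ℂ} (hΨ : IsAdditive p Ψ) {ι : Type*}
    (T : Finset ι) (J : ι → Set (Fin d → ℝ)) {I : Set (Fin d → ℝ)} (hI : I ∈ Lambda p)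
    (hJ : ∀ i ∈ T, J i ∈ Lambda p)
    (hd : ∀ i ∈ T, ∀ j ∈ T, i ≠ j → Disjoint (interior (J i)) (interior (J j)))
    (hU : ⋃ i ∈ T, J i = I) : Ψ I = ∑ i ∈ T, Ψ (J i) := by
  have key := hΨ I T.card (fun i => J (T.equivFin.symm i)) hI
    (fun i => hJ _ (T.equivFin.symm i).2)
    (fun i j hij => hd _ (T.equivFin.symm i).2 _ (T.equivFin.symm j).2
      (fun h => hij (T.equivFin.symm.injective (Subtype.ext h))))
    (by
      rw [← hU, T.equivFin.symm.surjective.iUnion_comp (fun i : T => J i)]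
      exact (Set.biUnion_eq_iUnion (T : Set ι) fun i _ => J i).symm)
  rw [key, Equiv.sum_comp T.equivFin.symm (fun i : T => Ψ (J i))]
  exact Finset.sum_coe_sort T fun i => Ψ (J i)

lemma IsAdditive.eq_sum_childIdx (hp : ∀ j i, 0 < p j i) {Ψ : Set (Fin d → ℝ) → ℂ}
    (hΨ : IsAdditive p Ψ) (k : ℕ) (n : Fin d → ℤ) :
    Ψ (cell p k n) = ∑ n' ∈ childIdx p k n, Ψ (cell p (k + 1) n') :=
  hΨ.eq_sum_finset _ _ ⟨k, n, rfl⟩ (fun n' _ => ⟨k + 1, n', rfl⟩)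
    (fun _ _ _ _ hne => disjoint_interior_cell hp _ hne) (cell_eq_biUnion hp k n).symm

end Cells

/-- The difference quotient `Ψ(I) / μ(I)` at `x`, where `I` is the parallelepiped of rank `k`
containing `x`. -/
def diffQuot {d : ℕ} (p : Fin d → ℕ → ℕ) (Ψ : Set (Fin d → ℝ) → ℂ) (k : ℕ) (x : Fin d → ℝ) : ℂ :=
  Ψ (cellAt p k x) / ((volume (cellAt p k x)).toReal : ℂ)

/-- The points of the half-open parallelepiped of rank `k` with index `n` which, for all `i < r`,
lie in a parallelepiped of rank `k + i` none of whose children has a difference quotient of norm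
larger than `c`. -/
def unstopped {d : ℕ} (p : Fin d → ℕ → ℕ) (Ψ : Set (Fin d → ℝ) → ℂ) (c : ℝ) (k : ℕ)
    (n : Fin d → ℤ) : ℕ → Set (Fin d → ℝ)
  | 0 => halfCell p k n
  | r + 1 => {x ∈ unstopped p Ψ c k n r | ∀ n' ∈ childIdx p (k + r) (cellIdx p (k + r) x),
      ‖Ψ (cell p (k + r + 1) n')‖ / (volume (cell p (k + r + 1) n')).toReal ≤ c}

section DiffQuot

variable {d : ℕ} {p : Fin d → ℕ → ℕ} {Ψ : Set (Fin d → ℝ) → ℂ}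

lemma measurable_diffQuot (k : ℕ) : Measurable (diffQuot p Ψ k) :=
  (measurable_of_countable fun n : Fin d → ℤ =>
    Ψ (cell p k n) / ((volume (cell p k n)).toReal : ℂ)).comp (measurable_cellIdx k)

lemma norm_diffQuot (k : ℕ) (x : Fin d → ℝ) :
    ‖diffQuot p Ψ k x‖ = ‖Ψ (cellAt p k x)‖ / (volume (cellAt p k x)).toReal := by
  rw [diffQuot, norm_div, Complex.norm_real, Real.norm_of_nonneg ENNReal.toReal_nonneg]

lemma diffQuot_of_mem_halfCell {k : ℕ} {n : Fin d → ℤ} {x : Fin d → ℝ} (hx : x ∈ halfCell p k n) :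
    diffQuot p Ψ k x = Ψ (cell p k n) / ((volume (cell p k n)).toReal : ℂ) := by
  have : cellIdx p k x = n := hx
  rw [diffQuot, cellAt_eq, this]

lemma integrableOn_diffQuot_halfCell (hp : ∀ j i, 0 < p j i) (k : ℕ) (n : Fin d → ℤ) :
    IntegrableOn (diffQuot p Ψ k) (halfCell p k n) := by
  refine IntegrableOn.congr_fun (f := fun _ => Ψ (cell p k n) /
    ((volume (cell p k n)).toReal : ℂ)) ?_ (fun x hx => (diffQuot_of_mem_halfCell hx).symm)
    (measurableSet_halfCell k n)
  refine integrableOn_const ?_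
  rw [measure_congr (halfCell_ae_eq hp k n)]
  exact volume_cell_ne_top k n

lemma setIntegral_diffQuot_halfCell (hp : ∀ j i, 0 < p j i) (k : ℕ) (n : Fin d → ℤ) :
    ∫ x in halfCell p k n, diffQuot p Ψ k x = Ψ (cell p k n) := by
  rw [setIntegral_congr_fun (measurableSet_halfCell k n)
    (fun x hx => diffQuot_of_mem_halfCell hx), setIntegral_const, measureReal_def,
    measure_congr (halfCell_ae_eq hp k n), Complex.real_smul, mul_div_cancel₀]
  exact_mod_cast (volume_cell_toReal_pos hp k n).ne'

lemma pairwiseDisjoint_halfCell (k : ℕ) (s : Set (Fin d → ℤ)) :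
    s.PairwiseDisjoint (halfCell p k) :=
  fun _ _ _ _ hne => disjoint_halfCell k hne

lemma setIntegral_diffQuot_biUnion (hp : ∀ j i, 0 < p j i) (k : ℕ) (N : Finset (Fin d → ℤ)) :
    ∫ x in ⋃ n ∈ N, halfCell p k n, diffQuot p Ψ k x = ∑ n ∈ N, Ψ (cell p k n) := by
  rw [integral_biUnion_finset N (fun n _ => measurableSet_halfCell k n)
    (pairwiseDisjoint_halfCell k _) fun n _ => integrableOn_diffQuot_halfCell hp k n]
  exact Finset.sum_congr rfl fun n _ => setIntegral_diffQuot_halfCell hp k n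

lemma integrableOn_diffQuot_succ_halfCell (hp : ∀ j i, 0 < p j i) (k : ℕ) (n : Fin d → ℤ) :
    IntegrableOn (diffQuot p Ψ (k + 1)) (halfCell p k n) := by
  rw [halfCell_eq_biUnion hp, integrableOn_finset_iUnion]
  exact fun n' _ => integrableOn_diffQuot_halfCell hp _ _

lemma setIntegral_diffQuot_succ_halfCell (hp : ∀ j i, 0 < p j i) (hΨ : IsAdditive p Ψ) (k : ℕ)
    (n : Fin d → ℤ) : ∫ x in halfCell p k n, diffQuot p Ψ (k + 1) x = Ψ (cell p k n) := by
  rw [halfCell_eq_biUnion hp, setIntegral_diffQuot_biUnion hp, hΨ.eq_sum_childIdx hp]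

lemma setIntegral_diffQuot_succ_biUnion (hp : ∀ j i, 0 < p j i) (hΨ : IsAdditive p Ψ) (k : ℕ)
    (N : Finset (Fin d → ℤ)) :
    ∫ x in ⋃ n ∈ N, halfCell p k n, diffQuot p Ψ (k + 1) x =
      ∫ x in ⋃ n ∈ N, halfCell p k n, diffQuot p Ψ k x := by
  rw [setIntegral_diffQuot_biUnion hp, integral_biUnion_finset N
    (fun n _ => measurableSet_halfCell k n) (pairwiseDisjoint_halfCell k _)
    fun n _ => integrableOn_diffQuot_succ_halfCell hp k n]
  exact Finset.sum_congr rfl fun n _ => setIntegral_diffQuot_succ_halfCell hp hΨ k n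

lemma exists_eq_biUnion_halfCell {k l : ℕ} {n : Fin d → ℤ} {A : Set (Fin d → ℝ)}
    (hA : A ⊆ cell p k n) (hsat : ∀ x ∈ A, ∀ y, cellIdx p l x = cellIdx p l y → y ∈ A) :
    ∃ N : Finset (Fin d → ℤ), A = ⋃ n ∈ N, halfCell p l n := by
  have hfin : (cellIdx p l '' A).Finite :=
    (finite_cellIdx_image k l n).subset (Set.image_mono hA)
  refine ⟨hfin.toFinset, ?_⟩
  ext y
  simp only [Set.Finite.mem_toFinset, Set.mem_image, Set.mem_iUnion, exists_prop, halfCell,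
    Set.mem_preimage, Set.mem_singleton_iff]
  constructor
  · exact fun hy => ⟨_, ⟨y, hy, rfl⟩, rfl⟩
  · rintro ⟨_, ⟨x, hx, rfl⟩, hxy⟩
    exact hsat x hx y hxy.symm

end DiffQuot

section Unstopped

variable {d : ℕ} {p : Fin d → ℕ → ℕ} {Ψ : Set (Fin d → ℝ) → ℂ} {c : ℝ} {k : ℕ} {n : Fin d → ℤ}

lemma unstopped_succ_subset (r : ℕ) : unstopped p Ψ c k n (r + 1) ⊆ unstopped p Ψ c k n r :=
  fun _ hx => hx.1

lemma unstopped_antitone : Antitone (unstopped p Ψ c k n) :=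
  antitone_nat_of_succ_le unstopped_succ_subset

lemma unstopped_subset_halfCell (r : ℕ) : unstopped p Ψ c k n r ⊆ halfCell p k n :=
  unstopped_antitone (Nat.zero_le r)

lemma mem_unstopped_of_cellIdx_eq (hp : ∀ j i, 0 < p j i) (r : ℕ) :
    ∀ x ∈ unstopped p Ψ c k n r, ∀ y, cellIdx p (k + r) x = cellIdx p (k + r) y →
      y ∈ unstopped p Ψ c k n r := by
  induction r with
  | zero => exact fun x hx y hxy => hxy.symm.trans hx
  | succ r ih =>
    intro x hx y hxy
    have hxy' : cellIdx p (k + r) x = cellIdx p (k + r) y := cellIdx_eq_of_succ hp hxy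
    exact ⟨ih x hx.1 y hxy', by rw [← hxy']; exact hx.2⟩

lemma mem_diff_unstopped_of_cellIdx_eq (hp : ∀ j i, 0 < p j i) (r : ℕ) :
    ∀ x ∈ unstopped p Ψ c k n r \ unstopped p Ψ c k n (r + 1), ∀ y,
      cellIdx p (k + r) x = cellIdx p (k + r) y →
      y ∈ unstopped p Ψ c k n r \ unstopped p Ψ c k n (r + 1) := by
  intro x hx y hxy
  refine ⟨mem_unstopped_of_cellIdx_eq hp r x hx.1 y hxy, fun hy => hx.2 ⟨hx.1, ?_⟩⟩
  rw [hxy]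
  exact hy.2

lemma exists_unstopped_eq (hp : ∀ j i, 0 < p j i) (r : ℕ) :
    ∃ N : Finset (Fin d → ℤ), unstopped p Ψ c k n r = ⋃ n ∈ N, halfCell p (k + r) n :=
  exists_eq_biUnion_halfCell ((unstopped_subset_halfCell r).trans (halfCell_subset_cell hp k n))
    (mem_unstopped_of_cellIdx_eq hp r)

lemma exists_diff_unstopped_eq (hp : ∀ j i, 0 < p j i) (r : ℕ) :
    ∃ N : Finset (Fin d → ℤ), unstopped p Ψ c k n r \ unstopped p Ψ c k n (r + 1) =
      ⋃ n ∈ N, halfCell p (k + r) n :=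
  exists_eq_biUnion_halfCell ((Set.sdiff_subset.trans (unstopped_subset_halfCell r)).trans
    (halfCell_subset_cell hp k n)) (mem_diff_unstopped_of_cellIdx_eq hp r)

lemma measurableSet_unstopped (hp : ∀ j i, 0 < p j i) (r : ℕ) :
    MeasurableSet (unstopped p Ψ c k n r) := by
  obtain ⟨N, hN⟩ := exists_unstopped_eq (Ψ := Ψ) (c := c) (k := k) (n := n) hp r
  rw [hN]
  exact N.measurableSet_biUnion fun n _ => measurableSet_halfCell _ n

lemma norm_diffQuot_le_of_mem_unstopped (hp : ∀ j i, 0 < p j i)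
    (h0 : ‖Ψ (cell p k n)‖ / (volume (cell p k n)).toReal ≤ c) (r : ℕ) {x : Fin d → ℝ}
    (hx : x ∈ unstopped p Ψ c k n r) : ‖diffQuot p Ψ (k + r) x‖ ≤ c := by
  rw [norm_diffQuot, cellAt_eq]
  cases r with
  | zero =>
    have : cellIdx p k x = n := hx
    simpa [this] using h0
  | succ r => exact hx.2 _ (cellIdx_mem_childIdx hp _ x)

lemma volume_halfCell_ne_top (hp : ∀ j i, 0 < p j i) (k : ℕ) (n : Fin d → ℤ) :
    volume (halfCell p k n) ≠ ⊤ := by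
  rw [measure_congr (halfCell_ae_eq hp k n)]
  exact volume_cell_ne_top k n

lemma integrableOn_diffQuot_succ_unstopped (hp : ∀ j i, 0 < p j i) (r : ℕ) :
    IntegrableOn (diffQuot p Ψ (k + r + 1)) (unstopped p Ψ c k n r) := by
  obtain ⟨N, hN⟩ := exists_unstopped_eq (Ψ := Ψ) (c := c) (k := k) (n := n) hp r
  rw [hN, integrableOn_finset_iUnion]
  exact fun n' _ => integrableOn_diffQuot_succ_halfCell hp _ _

lemma norm_sub_setIntegral_unstopped_le (hp : ∀ j i, 0 < p j i) (hΨ : IsAdditive p Ψ)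
    (h0 : ‖Ψ (cell p k n)‖ / (volume (cell p k n)).toReal ≤ c) (r : ℕ) :
    ‖Ψ (cell p k n) - ∫ x in unstopped p Ψ c k n r, diffQuot p Ψ (k + r) x‖ ≤
      c * volume.real (halfCell p k n \ unstopped p Ψ c k n r) := by
  induction r with
  | zero => simp [unstopped, setIntegral_diffQuot_halfCell hp]
  | succ r ih =>
    set U := unstopped p Ψ c k n with hU
    have hfin : volume (halfCell p k n) ≠ ⊤ := volume_halfCell_ne_top hp k n
    have hUm : ∀ r, MeasurableSet (U r) := fun r => measurableSet_unstopped hp r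
    have h1 : ∫ x in U r, diffQuot p Ψ (k + r) x = ∫ x in U r, diffQuot p Ψ (k + r + 1) x := by
      obtain ⟨N, hN⟩ := exists_unstopped_eq (Ψ := Ψ) (c := c) (k := k) (n := n) hp r
      rw [hU, hN, setIntegral_diffQuot_succ_biUnion hp hΨ]
    have h2 : ∫ x in U r \ U (r + 1), diffQuot p Ψ (k + r) x =
        ∫ x in U r \ U (r + 1), diffQuot p Ψ (k + r + 1) x := by
      obtain ⟨N, hN⟩ := exists_diff_unstopped_eq (Ψ := Ψ) (c := c) (k := k) (n := n) hp r
      rw [hU, hN, setIntegral_diffQuot_succ_biUnion hp hΨ]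
    have h3 : ∫ x in U r \ U (r + 1), diffQuot p Ψ (k + r + 1) x =
        (∫ x in U r, diffQuot p Ψ (k + r + 1) x) - ∫ x in U (r + 1), diffQuot p Ψ (k + r + 1) x :=
      setIntegral_sdiff (hUm _) (integrableOn_diffQuot_succ_unstopped hp r)
        (unstopped_succ_subset r)
    have h4 : ‖∫ x in U r \ U (r + 1), diffQuot p Ψ (k + r) x‖ ≤
        c * volume.real (U r \ U (r + 1)) :=
      norm_setIntegral_le_of_norm_le_const
        ((measure_mono (Set.sdiff_subset.trans (unstopped_subset_halfCell r))).trans_lt hfin.lt_top)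
        fun x hx => norm_diffQuot_le_of_mem_unstopped hp h0 r hx.1
    have h5 : volume.real (halfCell p k n \ U (r + 1)) =
        volume.real (halfCell p k n \ U r) + volume.real (U r \ U (r + 1)) := by
      rw [← measureReal_union (Set.disjoint_left.2 fun x hx hx' => hx.2 hx'.1)
        ((hUm _).diff (hUm _)) (measure_ne_top_of_subset Set.sdiff_subset hfin)
        (measure_ne_top_of_subset (Set.sdiff_subset.trans (unstopped_subset_halfCell r)) hfin),
        Set.sdiff_union_sdiff_cancel (unstopped_subset_halfCell r) (unstopped_succ_subset r)]
    have h6 : Ψ (cell p k n) - ∫ x in U (r + 1), diffQuot p Ψ (k + (r + 1)) x =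
        (Ψ (cell p k n) - ∫ x in U r, diffQuot p Ψ (k + r) x) +
          ∫ x in U r \ U (r + 1), diffQuot p Ψ (k + r) x := by
      rw [h2, h3, h1, ← add_assoc k r 1]
      ring
    rw [h5, h6, mul_add]
    exact (norm_add_le _ _).trans (add_le_add ih h4)

/-- Every stopped parallelepiped meets the set where the majorant exceeds the level in a fixed
proportion of its measure. -/
lemma volume_diff_unstopped_le (hp : ∀ j i, 0 < p j i) {M : ℕ} (hM : ∀ j i, p j i ≤ M)
    {E : Set (Fin d → ℝ)}
    (hE : ∀ l n', c < ‖Ψ (cell p l n')‖ / (volume (cell p l n')).toReal →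
      cell p l n' ∩ halfCell p k n ⊆ E) (r : ℕ) :
    volume (halfCell p k n \ unstopped p Ψ c k n r) ≤
      (M : ENNReal) ^ d * volume.restrict E (halfCell p k n \ unstopped p Ψ c k n r) := by
  induction r with
  | zero => simp [unstopped]
  | succ r ih =>
    set U := unstopped p Ψ c k n with hU
    have hUm : ∀ r, MeasurableSet (U r) := fun r => measurableSet_unstopped hp r
    have hsplit : ∀ μ : Measure (Fin d → ℝ), μ (halfCell p k n \ U (r + 1)) =
        μ (halfCell p k n \ U r) + μ (U r \ U (r + 1)) := fun μ => by
      rw [← measure_union (Set.disjoint_left.2 fun x hx hx' => hx.2 hx'.1)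
        ((hUm _).diff (hUm _)),
        Set.sdiff_union_sdiff_cancel (unstopped_subset_halfCell r) (unstopped_succ_subset r)]
    rw [hsplit, hsplit, mul_add]
    refine add_le_add ih ?_
    obtain ⟨N, hN⟩ := exists_diff_unstopped_eq (Ψ := Ψ) (c := c) (k := k) (n := n) hp r
    have hsub : ∀ m ∈ N, halfCell p (k + r) m ⊆ U r \ U (r + 1) := fun m hm => by
      rw [hU, hN]
      exact Set.subset_biUnion_of_mem (u := fun m => halfCell p (k + r) m) hm
    rw [hU, hN, measure_biUnion_finset (pairwiseDisjoint_halfCell _ _)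
      (fun m _ => measurableSet_halfCell _ m), measure_biUnion_finset
      (pairwiseDisjoint_halfCell _ _) (fun m _ => measurableSet_halfCell _ m), Finset.mul_sum]
    refine Finset.sum_le_sum fun m hm => ?_
    obtain ⟨x, hx⟩ : (halfCell p (k + r) m).Nonempty := by
      by_contra hne
      have := closure_halfCell hp (k + r) m
      rw [Set.not_nonempty_iff_eq_empty.1 hne, closure_empty] at this
      exact (cell_nonempty hp (k + r) m).ne_empty this.symm
    have hxm : cellIdx p (k + r) x = m := hx
    obtain ⟨n', hn', hbad⟩ : ∃ n' ∈ childIdx p (k + r) m,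
        c < ‖Ψ (cell p (k + r + 1) n')‖ / (volume (cell p (k + r + 1) n')).toReal := by
      by_contra! hcon
      exact (hsub m hm hx).2 ⟨(hsub m hm hx).1, by rwa [hxm]⟩
    have hchild : halfCell p (k + r + 1) n' ⊆ halfCell p (k + r) m := by
      rw [halfCell_eq_biUnion hp (k + r) m]
      exact Set.subset_biUnion_of_mem (u := fun n' => halfCell p (k + r + 1) n') hn'
    have hchildE : halfCell p (k + r + 1) n' ⊆ E := fun y hy =>
      hE _ _ hbad ⟨halfCell_subset_cell hp _ _ hy,
        unstopped_subset_halfCell r (hsub m hm (hchild hy)).1⟩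
    calc volume (halfCell p (k + r) m) = volume (cell p (k + r) m) :=
          measure_congr (halfCell_ae_eq hp _ _)
      _ ≤ (M : ENNReal) ^ d * volume (cell p (k + r + 1) n') := volume_cell_le_mul hp hM _ _ _
      _ = (M : ENNReal) ^ d * volume.restrict E (halfCell p (k + r + 1) n') := by
          rw [Measure.restrict_apply (measurableSet_halfCell _ _),
            Set.inter_eq_left.2 hchildE, measure_congr (halfCell_ae_eq hp _ _)]
      _ ≤ _ := by gcongr

end Unstopped

section Reconstruction

variable {d : ℕ} {p : Fin d → ℕ → ℕ} {Ψ : Set (Fin d → ℝ) → ℂ}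

lemma nullMeasurableSet_starGt {μ : Measure (Fin d → ℝ)} {g : (Fin d → ℝ) → ℝ}
    (hg : AEMeasurable g μ) : NullMeasurableSet (starGt p Ψ g) μ := by
  have : starGt p Ψ g = ⋃ k, ⋃ n, cell p k n ∩
      {x | g x < ‖Ψ (cell p k n)‖ / (volume (cell p k n)).toReal} := by
    ext x
    simp only [starGt, Lambda, Set.mem_ofPred_eq, Set.mem_iUnion, Set.mem_inter_iff]
    constructor
    · rintro ⟨_, ⟨k, n, rfl⟩, hx⟩
      exact ⟨k, n, hx⟩
    · rintro ⟨k, n, hx⟩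
      exact ⟨_, ⟨k, n, rfl⟩, hx⟩
  rw [this]
  exact .iUnion fun k => .iUnion fun n =>
    (measurableSet_cell k n).nullMeasurableSet.inter (nullMeasurableSet_lt hg aemeasurable_const)

lemma norm_trunc_le {α : Type*} {f : α → ℂ} {g : α → ℝ} {x : α} (hx : 0 ≤ g x) :
    ‖trunc f g x‖ ≤ g x := by
  unfold trunc
  split_ifs with h
  · exact h
  · simpa using hx

lemma integrable_trunc {α : Type*} [MeasurableSpace α] {μ : Measure α} {f : α → ℂ} {g : α → ℝ}
    (hf : AEStronglyMeasurable f μ) (hg : Integrable g μ) (h0 : ∀ᵐ x ∂μ, 0 ≤ g x) :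
    Integrable (trunc f g) μ := by
  have heq : trunc f g = {x | ‖f x‖ ≤ g x}.indicator f := by
    ext x
    simp [trunc, Set.indicator_apply]
  refine hg.mono' ?_ (h0.mono fun x hx => norm_trunc_le hx)
  rw [heq]
  exact hf.indicator₀ (nullMeasurableSet_le hf.norm.aemeasurable hg.aemeasurable)

/-- Local reconstruction estimate on a parallelepiped on which `g` is almost constant. -/
lemma norm_sub_setIntegral_trunc_le (hp : ∀ j i, 0 < p j i) {M : ℕ} (hM : ∀ j i, p j i ≤ M)
    (hΨ : IsAdditive p Ψ) {f : (Fin d → ℝ) → ℂ} {g : (Fin d → ℝ) → ℝ} {C : ℝ}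
    {k : ℕ} {n : Fin d → ℤ} (hg0 : ∀ x ∈ cell p k n, 0 ≤ g x) (hgi : IntegrableOn g (cell p k n))
    (hC : ∀ x ∈ cell p k n, ∀ y ∈ cell p k n, g x ≤ C * g y)
    (hlt : ∫ x in cell p k n, (starGt p Ψ g).indicator g x < ∫ x in cell p k n, g x)
    (hderiv : ∀ᵐ x ∂(volume.restrict (cell p k n)),
      Tendsto (fun l => diffQuot p Ψ l x) atTop (𝓝 (f x))) :
    ‖Ψ (cell p k n) - ∫ x in cell p k n, trunc f g x‖ ≤
      (2 * (M : ℝ) ^ d + 1) * (C * ∫ x in cell p k n, (starGt p Ψ g).indicator g x) := by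
  set J := cell p k n with hJ
  set E := starGt p Ψ g with hE
  set Q := halfCell p k n with hQ
  have hQJ : Q ⊆ J := halfCell_subset_cell hp k n
  have hQm : MeasurableSet Q := measurableSet_halfCell k n
  have hQfin : volume Q ≠ ⊤ := volume_halfCell_ne_top hp k n
  have : IsFiniteMeasure (volume.restrict Q) := isFiniteMeasure_restrict.2 hQfin
  have hres : volume.restrict J = volume.restrict Q :=
    (Measure.restrict_congr_set (halfCell_ae_eq hp k n)).symm
  obtain ⟨x₀, hx₀⟩ : J.Nonempty := cell_nonempty hp k n
  obtain ⟨c, hgc, hcC⟩ : ∃ c, (∀ x ∈ J, g x ≤ c) ∧ ∀ x ∈ J, c ≤ C * g x := by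
    have hbdd : BddAbove (g '' J) := ⟨C * g x₀, by rintro _ ⟨x, hx, rfl⟩; exact hC x hx x₀ hx₀⟩
    refine ⟨sSup (g '' J), fun x hx => le_csSup hbdd ⟨x, hx, rfl⟩, fun y hy => ?_⟩
    exact csSup_le ⟨_, x₀, hx₀, rfl⟩ (by rintro _ ⟨x, hx, rfl⟩; exact hC x hx y hy)
  have hc0 : 0 ≤ c := (hg0 x₀ hx₀).trans (hgc x₀ hx₀)
  have hbadE : ∀ l n', c < ‖Ψ (cell p l n')‖ / (volume (cell p l n')).toReal →
      cell p l n' ∩ J ⊆ E := fun l n' hbad x hx =>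
    ⟨_, ⟨l, n', rfl⟩, hx.1, (hgc x hx.2).trans_lt hbad⟩
  have h0 : ‖Ψ (cell p k n)‖ / (volume (cell p k n)).toReal ≤ c := by
    by_contra! hbad
    refine hlt.ne (setIntegral_congr_fun (measurableSet_cell k n) fun x hx => ?_)
    exact Set.indicator_of_mem (hbadE k n hbad ⟨hx, hx⟩) g
  rw [hres] at hderiv hlt ⊢
  replace hgi : Integrable g (volume.restrict Q) := by rw [← hres]; exact hgi
  have hEm : NullMeasurableSet E (volume.restrict Q) := nullMeasurableSet_starGt hgi.aemeasurable
  have hQae : ∀ᵐ x ∂(volume.restrict Q), x ∈ Q := ae_restrict_mem hQm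
  have hfm : AEStronglyMeasurable f (volume.restrict Q) :=
    aestronglyMeasurable_of_tendsto_ae atTop
      (fun l => (measurable_diffQuot l).aestronglyMeasurable) hderiv
  set b := (volume.restrict Q).real E with hb
  set e := ∫ x in Q, E.indicator g x with he
  have hcb : c * b ≤ C * e := by
    have h1 : c * b = ∫ x in Q, E.indicator (fun _ => c) x := by
      rw [integral_indicator₀ hEm, setIntegral_const, smul_eq_mul, mul_comm]
    rw [h1, he, ← integral_const_mul]
    refine integral_mono_ae ((integrable_const c).indicator₀ hEm)
      ((hgi.indicator₀ hEm).const_mul C) (hQae.mono fun x hx => ?_)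
    by_cases hxE : x ∈ E
    · simpa [hxE] using hcC x (hQJ hx)
    · simp [hxE]
  set U := unstopped p Ψ c k n with hU
  have hUm : ∀ r, MeasurableSet (U r) := fun r => measurableSet_unstopped hp r
  have hUQ : ∀ r, U r ⊆ Q := unstopped_subset_halfCell
  have hmeas : ∀ r, volume (Q \ U r) ≤ (M : ENNReal) ^ d * volume.restrict Q E := fun r => by
    refine (volume_diff_unstopped_le hp hM (fun l n' hbad =>
      (Set.inter_subset_inter_right _ hQJ).trans (hbadE l n' hbad)) r).trans ?_
    rw [Measure.restrict_apply' hQm, Set.inter_comm E, ← Measure.restrict_apply hQm]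
    exact mul_le_mul_right (measure_mono Set.sdiff_subset) _
  set G := ⋂ r, U r with hG
  have hGm : MeasurableSet G := .iInter hUm
  have hmeasG : volume (Q \ G) ≤ (M : ENNReal) ^ d * volume.restrict Q E := by
    have hmono : Monotone fun r => Q \ U r := fun _ _ hrs =>
      Set.sdiff_subset_sdiff_right (unstopped_antitone hrs)
    rw [hG, Set.sdiff_iInter, hmono.measure_iUnion]
    exact iSup_le hmeas
  have hreal : ∀ S : Set (Fin d → ℝ), volume S ≤ (M : ENNReal) ^ d * volume.restrict Q E →
      c * volume.real S ≤ (M : ℝ) ^ d * (C * e) := fun S hS => by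
    have h1 : volume.real S ≤ (M : ℝ) ^ d * b := by
      have := ENNReal.toReal_mono (ENNReal.mul_ne_top (by finiteness) (measure_ne_top _ _)) hS
      simpa [Measure.real, hb] using this
    calc c * volume.real S ≤ c * ((M : ℝ) ^ d * b) := by gcongr
      _ = (M : ℝ) ^ d * (c * b) := by ring
      _ ≤ _ := by gcongr
  have hlim : Tendsto (fun r => ∫ x in U r, diffQuot p Ψ (k + r) x) atTop
      (𝓝 (∫ x in Q, G.indicator f x)) := by
    have h1 : ∀ r, ∫ x in U r, diffQuot p Ψ (k + r) x =
        ∫ x in Q, (U r).indicator (diffQuot p Ψ (k + r)) x := fun r => by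
      rw [setIntegral_indicator (hUm r), Set.inter_eq_right.2 (hUQ r)]
    simp only [h1]
    refine tendsto_integral_of_dominated_convergence (fun _ => c)
      (fun r => ((measurable_diffQuot _).indicator (hUm r)).aestronglyMeasurable)
      (integrable_const c) (fun r => .of_forall fun x => ?_) (hderiv.mono fun x hx => ?_)
    · by_cases hxU : x ∈ U r
      · simpa [hxU] using norm_diffQuot_le_of_mem_unstopped hp h0 r hxU
      · simpa [hxU] using hc0
    · by_cases hxG : x ∈ G
      · have hxU : ∀ r, x ∈ U r := Set.mem_iInter.1 hxG
        simp only [hxG, hxU, Set.indicator_of_mem]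
        exact hx.comp (tendsto_add_atTop_nat k |>.congr fun r => Nat.add_comm r k)
      · obtain ⟨r₀, hr₀⟩ : ∃ r, x ∉ U r := by simpa [hG] using hxG
        rw [Set.indicator_of_notMem hxG]
        refine tendsto_const_nhds.congr' ?_
        filter_upwards [eventually_ge_atTop r₀] with r hr
        exact (Set.indicator_of_notMem (fun hxr => hr₀ (unstopped_antitone hr hxr)) _).symm
  have hmain : ‖Ψ (cell p k n) - ∫ x in Q, G.indicator f x‖ ≤ (M : ℝ) ^ d * (C * e) :=
    le_of_tendsto (tendsto_const_nhds.sub hlim).norm (.of_forall fun r =>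
      (norm_sub_setIntegral_unstopped_le hp hΨ h0 r).trans (hreal _ (hmeas r)))
  have hfG : ∀ᵐ x ∂(volume.restrict Q), x ∈ G → ‖f x‖ ≤ c := by
    filter_upwards [hderiv] with x hx hxG
    refine le_of_tendsto (hx.comp (tendsto_add_atTop_nat k)).norm (.of_forall fun r => ?_)
    have := norm_diffQuot_le_of_mem_unstopped hp h0 r (Set.mem_iInter.1 hxG r)
    rwa [Nat.add_comm] at this
  have hfE : ∀ᵐ x ∂(volume.restrict Q), x ∉ E → ‖f x‖ ≤ g x := by
    filter_upwards [hderiv] with x hx hxE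
    refine le_of_tendsto hx.norm (.of_forall fun l => ?_)
    rw [norm_diffQuot]
    by_contra! hlt'
    exact hxE ⟨_, ⟨l, _, rfl⟩, mem_cellAt hp l x, hlt'⟩
  have hGi : Integrable (G.indicator f) (volume.restrict Q) := by
    refine (integrable_const c).mono' (hfm.indicator hGm) (hfG.mono fun x hx => ?_)
    by_cases hxG : x ∈ G
    · simpa [hxG] using hx hxG
    · simpa [hxG] using hc0
  have htr : Integrable (trunc f g) (volume.restrict Q) :=
    integrable_trunc hfm hgi (hQae.mono fun x hx => hg0 x (hQJ hx))
  have hQGi : Integrable ((Q \ G).indicator fun _ => c) (volume.restrict Q) :=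
    (integrable_const c).indicator (hQm.diff hGm)
  have hEi : Integrable (E.indicator fun _ => c) (volume.restrict Q) :=
    (integrable_const c).indicator₀ hEm
  have hdiff : ‖(∫ x in Q, G.indicator f x) - ∫ x in Q, trunc f g x‖ ≤
      (M : ℝ) ^ d * (C * e) + C * e := by
    rw [← integral_sub hGi htr]
    have hbound : ‖∫ x in Q, (G.indicator f x - trunc f g x)‖ ≤
        ∫ x in Q, ((Q \ G).indicator (fun _ => c) x + E.indicator (fun _ => c) x) := by
      refine norm_integral_le_of_norm_le (hQGi.add hEi) ?_
      filter_upwards [hfG, hfE, hQae] with x hxfG hxfE hxQ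
      have hEnn : 0 ≤ E.indicator (fun _ => c) x := Set.indicator_nonneg (fun _ _ => hc0) x
      by_cases hxG : x ∈ G
      · rw [Set.indicator_of_mem hxG, Set.indicator_of_notMem (fun hx => hx.2 hxG), zero_add]
        by_cases hx : ‖f x‖ ≤ g x
        · simpa [trunc, hx] using hEnn
        · have hxE : x ∈ E := by_contra fun hxE => hx (hxfE hxE)
          simpa [trunc, hx, hxE] using hxfG hxG
      · have hxQG : x ∈ Q \ G := ⟨hxQ, hxG⟩
        rw [Set.indicator_of_notMem hxG, Set.indicator_of_mem hxQG, zero_sub, norm_neg]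
        have := (norm_trunc_le (f := f) (hg0 x (hQJ hxQ))).trans (hgc x (hQJ hxQ))
        linarith
    refine hbound.trans ?_
    rw [integral_add hQGi hEi, integral_indicator₀ hEm, setIntegral_const,
      setIntegral_indicator (hQm.diff hGm), setIntegral_const,
      Set.inter_eq_right.2 Set.sdiff_subset, smul_eq_mul, smul_eq_mul, mul_comm _ c, mul_comm _ c]
    exact add_le_add (hreal _ hmeasG) hcb
  calc ‖Ψ (cell p k n) - ∫ x in Q, trunc f g x‖
      = ‖(Ψ (cell p k n) - ∫ x in Q, G.indicator f x) +
          ((∫ x in Q, G.indicator f x) - ∫ x in Q, trunc f g x)‖ := by rw [sub_add_sub_cancel]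
    _ ≤ (M : ℝ) ^ d * (C * e) + ((M : ℝ) ^ d * (C * e) + C * e) :=
        (norm_add_le _ _).trans (add_le_add hmain hdiff)
    _ = (2 * (M : ℝ) ^ d + 1) * (C * e) := by ring

lemma interior_ae_eq_of_mem_Lambda {J : Set (Fin d → ℝ)} (hJ : J ∈ Lambda p) :
    interior J =ᵐ[volume] J := by
  obtain ⟨k, n, rfl⟩ := hJ
  exact interior_cell_ae_eq k n

lemma setIntegral_eq_sum_of_partition {ι F : Type*} [NormedAddCommGroup F] [NormedSpace ℝ F]
    {T : Finset ι} {J : ι → Set (Fin d → ℝ)} {I : Set (Fin d → ℝ)}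
    (hJ : ∀ i ∈ T, J i ∈ Lambda p)
    (hd : ∀ i ∈ T, ∀ j ∈ T, i ≠ j → Disjoint (interior (J i)) (interior (J j)))
    (hU : ⋃ i ∈ T, J i = I) {u : (Fin d → ℝ) → F} (hu : IntegrableOn u I) :
    ∫ x in I, u x = ∑ i ∈ T, ∫ x in J i, u x := by
  have hae : (⋃ i ∈ (T : Set ι), interior (J i)) =ᵐ[volume] ⋃ i ∈ (T : Set ι), J i :=
    Filter.EventuallyEq.countable_bUnion T.countable_toSet fun i hi =>
      interior_ae_eq_of_mem_Lambda (hJ i hi)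
  subst hU
  refine (setIntegral_congr_set hae.symm).trans ?_
  refine (integral_biUnion_finset T (fun i _ => isOpen_interior.measurableSet)
    (fun i hi j hj hij => hd i hi j hj hij) fun i hi => hu.mono_set
      (interior_subset.trans (Set.subset_biUnion_of_mem (u := J) hi))).trans ?_
  exact Finset.sum_congr rfl fun i hi =>
    setIntegral_congr_set (interior_ae_eq_of_mem_Lambda (hJ i hi))

/-- Reconstruction estimate on a parallelepiped partitioned into finitely many parallelepipeds on
each of which `g` is almost constant. -/
lemma norm_sub_setIntegral_trunc_le_of_partition (hp : ∀ j i, 0 < p j i) {M : ℕ}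
    (hM : ∀ j i, p j i ≤ M) (hΨ : IsAdditive p Ψ) {f : (Fin d → ℝ) → ℂ} {g : (Fin d → ℝ) → ℝ}
    {C : ℝ} {ι : Type*} {T : Finset ι} {J : ι → Set (Fin d → ℝ)} {I : Set (Fin d → ℝ)}
    (hI : I ∈ Lambda p) (hJ : ∀ i ∈ T, J i ∈ Lambda p)
    (hd : ∀ i ∈ T, ∀ j ∈ T, i ≠ j → Disjoint (interior (J i)) (interior (J j)))
    (hU : ⋃ i ∈ T, J i = I) (hg0 : ∀ x ∈ I, 0 ≤ g x) (hgi : IntegrableOn g I)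
    (hC : ∀ i ∈ T, ∀ x ∈ J i, ∀ y ∈ J i, g x ≤ C * g y)
    (hlt : ∀ i ∈ T, ∫ x in J i, (starGt p Ψ g).indicator g x < ∫ x in J i, g x)
    (hderiv : ∀ᵐ x ∂(volume.restrict I), Tendsto (fun l => diffQuot p Ψ l x) atTop (𝓝 (f x))) :
    ‖Ψ I - ∫ x in I, trunc f g x‖ ≤
      (2 * (M : ℝ) ^ d + 1) * (C * ∫ x in I, (starGt p Ψ g).indicator g x) := by
  have hIm : MeasurableSet I := by
    obtain ⟨k, n, rfl⟩ := hI
    exact measurableSet_cell k n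
  have hJI : ∀ i ∈ T, J i ⊆ I := fun i hi => hU ▸ Set.subset_biUnion_of_mem (u := J) hi
  have hfm : AEStronglyMeasurable f (volume.restrict I) :=
    aestronglyMeasurable_of_tendsto_ae atTop
      (fun l => (measurable_diffQuot l).aestronglyMeasurable) hderiv
  have htr : IntegrableOn (trunc f g) I :=
    integrable_trunc hfm hgi ((ae_restrict_mem hIm).mono hg0)
  have hEi : IntegrableOn ((starGt p Ψ g).indicator g) I :=
    Integrable.indicator₀ hgi (nullMeasurableSet_starGt hgi.aemeasurable)
  rw [hΨ.eq_sum_finset T J hI hJ hd hU, setIntegral_eq_sum_of_partition hJ hd hU htr,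
    setIntegral_eq_sum_of_partition hJ hd hU hEi, ← Finset.sum_sub_distrib, Finset.mul_sum,
    Finset.mul_sum]
  refine norm_sum_le_of_le T fun i hi => ?_
  obtain ⟨k, n, hkn⟩ := hJ i hi
  have hJI' := hJI i hi
  have hCi := hC i hi
  have hlti := hlt i hi
  rw [hkn] at hJI' hCi hlti ⊢
  exact norm_sub_setIntegral_trunc_le hp hM hΨ (fun x hx => hg0 x (hJI' hx))
    (hgi.mono_set hJI') hCi hlti (ae_restrict_of_ae_restrict_of_subset hJI' hderiv)

/-- A parallelepiped inside a partitioned one is either contained in a member of the partition or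
the union of the members of the partition that it contains. -/
lemma biUnion_subset_eq_of_forall_not_subset (hp : ∀ j i, 0 < p j i) {I I0 : Set (Fin d → ℝ)}
    (hI : I ∈ Lambda p) (hsub : I ⊆ I0) {s : ℕ} {J : Fin s → Set (Fin d → ℝ)}
    (hJ : ∀ i, J i ∈ Lambda p) (hU : ⋃ i, J i = I0) (hnot : ∀ i, ¬ I ⊆ J i)
    {T : Finset (Fin s)} (hT : ∀ i, i ∈ T ↔ J i ⊆ I) : ⋃ i ∈ T, J i = I := by
  refine Set.Subset.antisymm (Set.iUnion₂_subset fun i hi => (hT i).1 hi) ?_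
  have hclosed : IsClosed (⋃ i ∈ T, J i) := T.finite_toSet.isClosed_biUnion fun i _ => by
    obtain ⟨k, n, hkn⟩ := hJ i
    exact hkn ▸ isClosed_cell k n
  have hint : interior I ⊆ ⋃ i ∈ T, J i := fun x hx => by
    obtain ⟨i, hi⟩ := Set.mem_iUnion.1 (hU.symm ▸ hsub (interior_subset hx) : x ∈ ⋃ i, J i)
    have hcl : x ∈ closure (interior (J i)) := by
      obtain ⟨k, n, hkn⟩ := hJ i
      rw [hkn] at hi ⊢
      rwa [closure_interior_cell hp]
    obtain ⟨y, hyI, hyJ⟩ := mem_closure_iff.1 hcl _ isOpen_interior hx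
    have hJI : J i ⊆ I :=
      (subset_or_subset_of_interior_inter hp (hJ i) hI hyJ hyI).resolve_right (hnot i)
    exact Set.mem_biUnion ((hT i).2 hJI) hi
  obtain ⟨k, n, rfl⟩ := hI
  rw [← closure_interior_cell hp]
  exact closure_minimal hint hclosed

end Reconstruction

/-- **Theorem (reconstruction of an additive function from its derivative).**
Let `𝒫 = {Pʲ}` with `sup_{i,j} pʲᵢ = M < ∞`, let `Ψ` be a complex-valued additive function
on the `𝒫`-adic parallelepipeds, `I₀ ∈ Λᵈ`, and let `{h m}` satisfy (h1)–(h3) on `I₀`.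
If `∫_{{x ∈ I₀ : Ψ*(x) > h m x}} h m → 0` and `Ψ'(x)` exists a.e. on `I₀` (with value
`f x`), then for every `I ∈ Λᵈ` with `I ⊆ I₀`,
`Ψ I = lim_m ∫_I [Ψ'(x)]_{h m x} dx`. -/
theorem reconstruction_additive_function
    (d : ℕ) (p : Fin d → ℕ → ℕ) (hp : ∀ j i, 2 ≤ p j i)
    (M : ℕ) (hM : ∀ j i, p j i ≤ M)
    (Ψ : Set (Fin d → ℝ) → ℂ) (hΨ : IsAdditive p Ψ)
    (I0 : Set (Fin d → ℝ)) (hI0 : I0 ∈ Lambda p)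
    (h : ℕ → (Fin d → ℝ) → ℝ) (hh : HConds p I0 h)
    (hsmall : Tendsto (fun m => ∫ x in I0 ∩ starGt p Ψ (h m), h m x) atTop (𝓝 0))
    (f : (Fin d → ℝ) → ℂ)
    (hderiv : ∀ᵐ x ∂(volume.restrict I0),
      Tendsto (fun k => Ψ (cellAt p k x) / ((volume (cellAt p k x)).toReal : ℂ))
        atTop (𝓝 (f x)))
    (I : Set (Fin d → ℝ)) (hI : I ∈ Lambda p) (hsub : I ⊆ I0) :
    Tendsto (fun m => ∫ x in I, trunc f (h m) x) atTop (𝓝 (Ψ I)) := by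
  have hp0 : ∀ j i, 0 < p j i := fun j i => two_pos.trans_le (hp j i)
  obtain ⟨hh1, C, hC0, ε, hε0, hpart⟩ := hh
  have hI0m : MeasurableSet I0 := by
    obtain ⟨k, n, rfl⟩ := hI0
    exact measurableSet_cell k n
  have hint : ∀ m, IntegrableOn (h m) I0 := fun m => by
    obtain ⟨s, J, -, -, hU, -, hε⟩ := hpart m
    rw [← hU, integrableOn_finite_iUnion]
    exact fun i => by_contra fun hni =>
      (hε0.trans_le (hε i)).ne' (integral_undef hni)
  have hEm : ∀ m, NullMeasurableSet (starGt p Ψ (h m)) (volume.restrict I0) := fun m =>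
    nullMeasurableSet_starGt (hint m).aemeasurable
  have hEi : ∀ m, IntegrableOn ((starGt p Ψ (h m)).indicator (h m)) I0 := fun m =>
    Integrable.indicator₀ (hint m) (hEm m)
  set e : ℕ → ℝ := fun m => ∫ x in I0, (starGt p Ψ (h m)).indicator (h m) x with he
  have he0 : Tendsto e atTop (𝓝 0) := by
    refine hsmall.congr fun m => ?_
    rw [he]
    dsimp only
    rw [integral_indicator₀ (hEm m), Measure.restrict_restrict₀ (hEm m), Set.inter_comm]
  have hle : ∀ m, ∀ S ⊆ I0, ∫ x in S, (starGt p Ψ (h m)).indicator (h m) x ≤ e m :=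
    fun m S hS => setIntegral_mono_set (hEi m)
      ((ae_restrict_mem hI0m).mono fun x hx => Set.indicator_apply_nonneg fun _ => (hh1 x hx).1 m)
      hS.eventuallyLE
  obtain ⟨k, n, hkn⟩ := hI
  have hI : I ∈ Lambda p := ⟨k, n, hkn⟩
  obtain ⟨x₀, hx₀⟩ : I.Nonempty := hkn ▸ cell_nonempty hp0 k n
  have hvol : 0 < volume.real I := hkn ▸ volume_cell_toReal_pos hp0 k n
  have hderivI : ∀ᵐ x ∂(volume.restrict I), Tendsto (fun l => diffQuot p Ψ l x) atTop (𝓝 (f x)) :=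
    ae_restrict_of_ae_restrict_of_subset hsub hderiv
  have hlarge : ∀ᶠ m in atTop, 1 < h m x₀ * (volume.real I / C) :=
    ((hh1 x₀ (hsub hx₀)).2.2.atTop_mul_const (by positivity)).eventually_gt_atTop 1
  have hbound : ∀ᶠ m in atTop, ‖(∫ x in I, trunc f (h m) x) - Ψ I‖ ≤
      (2 * (M : ℝ) ^ d + 1) * (C * e m) := by
    filter_upwards [hlarge, he0.eventually_lt_const hε0, he0.eventually_lt_const one_pos]
      with m hm1 hmε hm2
    obtain ⟨s, J, hJ, hdisj, hU, hCm, hε⟩ := hpart m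
    have hg0 : ∀ x ∈ I, 0 ≤ h m x := fun x hx => (hh1 x (hsub hx)).1 m
    have hgi : IntegrableOn (h m) I := (hint m).mono_set hsub
    rw [norm_sub_rev]
    suffices hest : ‖Ψ I - ∫ x in I, trunc f (h m) x‖ ≤ (2 * (M : ℝ) ^ d + 1) *
        (C * ∫ x in I, (starGt p Ψ (h m)).indicator (h m) x) from
      hest.trans (by gcongr; exact hle m I hsub)
    by_cases hcase : ∃ i, I ⊆ J i
    · obtain ⟨i, hi⟩ := hcase
      have hlt : ∫ x in I, (starGt p Ψ (h m)).indicator (h m) x < ∫ x in I, h m x := by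
        refine (hle m I hsub).trans_lt (hm2.trans (hm1.trans_le ?_))
        have hconst : ∫ _x in I, h m x₀ / C ≤ ∫ x in I, h m x := by
          refine setIntegral_mono_on ?_ hgi (hkn ▸ measurableSet_cell k n) fun x hx => ?_
          · exact integrableOn_const (hkn ▸ volume_cell_ne_top k n)
          · rw [div_le_iff₀' hC0]
            exact hCm i x₀ (hi hx₀) x (hi hx)
        refine le_trans (le_of_eq ?_) hconst
        rw [setIntegral_const, smul_eq_mul]
        ring
      subst hkn
      exact norm_sub_setIntegral_trunc_le hp0 hM hΨ hg0 hgi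
        (fun x hx y hy => hCm i x (hi hx) y (hi hy)) hlt hderivI
    · classical
      push Not at hcase
      have hT : ∀ i, i ∈ Finset.univ.filter (fun i => J i ⊆ I) ↔ J i ⊆ I := fun i => by simp
      exact norm_sub_setIntegral_trunc_le_of_partition hp0 hM hΨ hI (fun i _ => hJ i)
        (fun i _ j _ => hdisj i j)
        (biUnion_subset_eq_of_forall_not_subset hp0 hI hsub hJ hU hcase hT) hg0 hgi
        (fun i _ => hCm i) (fun i _ => (hle m _ (hU ▸ Set.subset_iUnion J i)).trans_lt
          (hmε.trans_le (hε i))) hderivI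
  refine tendsto_iff_norm_sub_tendsto_zero.2 (squeeze_zero' (.of_forall fun m => norm_nonneg _)
    hbound ?_)
  simpa using (he0.const_mul C).const_mul (2 * (M : ℝ) ^ d + 1)
end
end

section
/- Let $I \subset \mathbb R^n$ be a parallelepiped, $f : I \to \mathbb C$, and $\mathcal H = \{h_n\}$ a sequence of nonnegative integrable functions on $I$ with $h_1 \le h_2 \le \dots$ a.e. and $h_n(x) \to \infty$ a.e. If $\lim_{n \to \infty} \int_{\{x \in I : |f(x)| \ge h_n(x)\}} h_n(x)\,dx = 0$ and the limit $\lim_{n \to \infty} \int_I [f(x)]_{h_n(x)}\,dx$ exists, then there exists a sequence $\mathcal G = \{g_n\}$ of nonnegative integrable functions, nondecreasing in $n$ and tending to $\infty$ a.e., such that $f$ is $A\mathcal G$-integrable and $(A\mathcal G)\int_I f(x)\,dx = \lim_{n \to \infty} \int_I [f(x)]_{h_n(x)}\,dx$. -/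
open MeasureTheory Filter Topology

noncomputable section

/-- **Remark.**  Let `I ⊆ ℝⁿ` be a parallelepiped, `f : I → ℂ`, and `{h m}` a sequence of
nonnegative integrable functions on `I`, a.e. nondecreasing in `m` and tending to `∞` a.e.
If `∫_{{|f| ≥ h m}} h m → 0` and `∫_I [f]_{h m} → L`, then there is a sequence
`𝒢 = {g m}` of nonnegative integrable functions, a.e. nondecreasing and tending to `∞`
a.e., such that `f` is `A𝒢`-integrable with `(A𝒢)∫_I f = L`. -/
theorem exists_AG_integral_of_truncation_limit
    (n : ℕ) (a b : Fin n → ℝ) (I : Set (Fin n → ℝ)) (hIdef : I = Set.Icc a b)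
    (f : (Fin n → ℝ) → ℂ) (h : ℕ → (Fin n → ℝ) → ℝ)
    (hint : ∀ m, IntegrableOn (h m) I)
    (hpos : ∀ m, ∀ᵐ x ∂(volume.restrict I), 0 ≤ h m x)
    (hmono : ∀ᵐ x ∂(volume.restrict I), Monotone fun m => h m x)
    (htop : ∀ᵐ x ∂(volume.restrict I), Tendsto (fun m => h m x) atTop atTop)
    (hsmall : Tendsto (fun m => ∫ x in {x ∈ I | h m x ≤ ‖f x‖}, h m x) atTop (𝓝 0))
    (L : ℂ)
    (hlim : Tendsto (fun m => ∫ x in I, trunc f (h m) x) atTop (𝓝 L)) :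
    ∃ g : ℕ → (Fin n → ℝ) → ℝ,
      (∀ m, IntegrableOn (g m) I) ∧
      (∀ m, ∀ᵐ x ∂(volume.restrict I), 0 ≤ g m x) ∧
      (∀ᵐ x ∂(volume.restrict I), Monotone fun m => g m x) ∧
      (∀ᵐ x ∂(volume.restrict I), Tendsto (fun m => g m x) atTop atTop) ∧
      (∀ α > (0 : ℝ),
        Tendsto (fun m => ∫ x in {x ∈ I | α * g m x ≤ ‖f x‖}, g m x) atTop (𝓝 0)) ∧
      Tendsto (fun m => ∫ x in I, trunc f (g m) x) atTop (𝓝 L) := by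
  classical
  have hI : MeasurableSet I := hIdef ▸ measurableSet_Icc
  have hIfin : volume I ≠ ⊤ := by
    rw [hIdef]
    exact isCompact_Icc.measure_lt_top.ne
  set E : ℕ → Set (Fin n → ℝ) := fun m => {x ∈ I | h m x ≤ ‖f x‖}
  have hEI : ∀ m, E m ⊆ I := fun m x hx => hx.1
  have hEfin : ∀ m, volume (E m) ≠ ⊤ := fun m => measure_ne_top_of_subset (hEI m) hIfin
  -- `f` need not be measurable: replace `E m` by a decreasing sequence of measurable hulls.
  set T : ℕ → Set (Fin n → ℝ) := fun m => ⋂ j ∈ Set.Iic m, toMeasurable volume (E j)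
  have hTmeas : ∀ m, MeasurableSet (T m) := fun m =>
    MeasurableSet.biInter (Set.to_countable _) fun j _ => measurableSet_toMeasurable _ _
  have hTanti : Antitone T := fun i j hij =>
    Set.biInter_subset_biInter_left (Set.Iic_subset_Iic.2 hij)
  have hTE : ∀ m, volume.restrict (T m) ≤ volume.restrict (E m) := fun m => by
    rw [← Measure.restrict_toMeasurable (hEfin m)]
    exact Measure.restrict_mono (Set.biInter_subset_of_mem (Set.mem_Iic.2 le_rfl)) le_rfl
  rw [ae_restrict_iff' hI] at hmono htop
  have hpos' : ∀ᵐ x ∂volume, x ∈ I → ∀ m, 0 ≤ h m x := by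
    rw [← ae_restrict_iff' hI]
    exact ae_all_iff.2 hpos
  have hlt : ∀ᵐ x ∂volume, x ∈ I → ∀ m, x ∉ T m → ‖f x‖ < h m x := by
    filter_upwards [hmono] with x hx hxI m hxT
    by_contra! hle
    exact hxT (Set.mem_iInter₂.2 fun j hj =>
      subset_toMeasurable _ _ ⟨hxI, (hx hxI hj).trans hle⟩)
  set g : ℕ → (Fin n → ℝ) → ℝ := fun m => (T m).piecewise (h m) fun x => (m + 1 : ℝ) * h m x
  have hgT : ∀ m, ∀ x ∈ T m, g m x = h m x := fun m x hx => Set.piecewise_eq_of_mem _ _ _ hx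
  have hgT' : ∀ m, ∀ x ∉ T m, g m x = (m + 1 : ℝ) * h m x :=
    fun m x hx => Set.piecewise_eq_of_notMem _ _ _ hx
  have hhg : ∀ m x, 0 ≤ h m x → h m x ≤ g m x := fun m x hx => by
    by_cases hxT : x ∈ T m
    · exact (hgT m x hxT).ge
    · rw [hgT' m x hxT]
      nlinarith [(Nat.cast_nonneg m : (0 : ℝ) ≤ m)]
  refine ⟨g, fun m => ?_, fun m => ?_, ?_, ?_, fun α hα => ?_, ?_⟩
  · exact Integrable.piecewise (hTmeas m) (hint m).integrableOn
      ((hint m).const_mul _).integrableOn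
  · filter_upwards [hpos m] with x hx using hx.trans (hhg m x hx)
  · rw [ae_restrict_iff' hI]
    filter_upwards [hmono, hpos'] with x hx hp hxI i j hij
    have hij' : (i : ℝ) ≤ j := Nat.cast_le.2 hij
    have hh : h i x ≤ h j x := hx hxI hij
    by_cases hi : x ∈ T i
    · simpa only [hgT i x hi] using hh.trans (hhg j x (hp hxI j))
    · have hj : x ∉ T j := fun hj => hi (hTanti hij hj)
      simp only [hgT' i x hi, hgT' j x hj]
      exact mul_le_mul (by linarith) hh (hp hxI i) (by positivity)
  · rw [ae_restrict_iff' hI]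
    filter_upwards [htop, hpos'] with x hx hp hxI
    exact tendsto_atTop_mono (fun m => hhg m x (hp hxI m)) (hx hxI)
  · have hposE : ∀ m, ∀ᵐ x ∂volume.restrict (E m), 0 ≤ h m x := fun m =>
      ae_restrict_of_ae_restrict_of_subset (hEI m) (hpos m)
    have hposS : ∀ m, ∀ᵐ x ∂volume.restrict {x ∈ I | α * g m x ≤ ‖f x‖}, 0 ≤ g m x :=
      fun m => ae_restrict_of_ae_restrict_of_subset (fun x hx => hx.1) <| by
        filter_upwards [hpos m] with x hx using hx.trans (hhg m x hx)
    have hev : ∀ᶠ m : ℕ in atTop, 1 ≤ α * (m + 1 : ℝ) := by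
      filter_upwards [eventually_ge_atTop ⌈α⁻¹⌉₊] with m hm
      have : α⁻¹ ≤ m := Nat.ceil_le.1 hm
      calc (1 : ℝ) = α * α⁻¹ := (mul_inv_cancel₀ hα.ne').symm
        _ ≤ α * (m + 1 : ℝ) := by gcongr; linarith
    refine squeeze_zero' (Eventually.of_forall fun m => integral_nonneg_of_ae (hposS m)) ?_ hsmall
    filter_upwards [hev] with m hm
    have hST : {x ∈ I | α * g m x ≤ ‖f x‖} ≤ᵐ[volume] T m := by
      filter_upwards [hlt, hpos'] with x hx hp hxS
      by_contra hxT
      have h1 : α * g m x ≤ ‖f x‖ := hxS.2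
      rw [hgT' m x hxT] at h1
      have h2 := hx hxS.1 m hxT
      nlinarith [hp hxS.1 m]
    have hle := Measure.restrict_mono_ae hST
    calc ∫ x in {x ∈ I | α * g m x ≤ ‖f x‖}, g m x
        = ∫ x in {x ∈ I | α * g m x ≤ ‖f x‖}, h m x :=
          integral_congr_ae (ae_mono hle ((ae_restrict_mem (hTmeas m)).mono (hgT m)))
      _ ≤ ∫ x in E m, h m x :=
          integral_mono_measure (hle.trans (hTE m)) (hposE m) ((hint m).mono_set (hEI m))
  · refine hlim.congr fun m => integral_congr_ae ?_
    rw [EventuallyEq, ae_restrict_iff' hI]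
    filter_upwards [hlt, hpos'] with x hx hp hxI
    by_cases hxT : x ∈ T m
    · simp only [trunc, hgT m x hxT]
    · have h1 := (hx hxI m hxT).le
      simp only [trunc, if_pos h1, if_pos (h1.trans (hhg m x (hp hxI m)))]
end
end

section
/- Define $k_n = n(n-1)/2$ and, for each $n \in \mathbb N$, the function $h_n : [0,1] \to \mathbb R$ by $h_n(x) = 2^{k_n+j+1}$ for $x \in [1-2^{-(j-1)}, 1-2^{-j})$, $j = 1,\dots,n$, and $h_n(x) = 2^n$ for $x \in [1-2^{-n},1]$. Then the sequence $\{h_n\}$ satisfies conditions (h1)–(h3) on $I_0 = [0,1]$ with respect to the dyadic intervals. -/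
open MeasureTheory Filter Topology

noncomputable section

/-- `k_n = n(n-1)/2`. -/
def ksq (n : ℕ) : ℕ := n * (n - 1) / 2

/-- The function `h_n` of the example: `h_n(x) = 2^{k_n+j+1}` for
`x ∈ [1-2^{-(j-1)}, 1-2^{-j})`, `j = 1, …, n`, and `h_n(x) = 2^n` for `x ∈ [1-2^{-n}, 1]`. -/
def hfun (n : ℕ) (x : ℝ) : ℝ :=
  if 1 - 1 / 2 ^ n ≤ x then 2 ^ n
  else ∑ j ∈ Finset.Icc 1 n,
    if 1 - 1 / 2 ^ (j - 1) ≤ x ∧ x < 1 - 1 / 2 ^ j then (2 : ℝ) ^ (ksq n + j + 1) else 0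

/-- The collection of dyadic intervals `[m/2ᵏ, (m+1)/2ᵏ]`. -/
def dyadicSet : Set (Set ℝ) :=
  {I | ∃ (k : ℕ) (n : ℤ), I = Set.Icc ((n : ℝ) / 2 ^ k) (((n : ℝ) + 1) / 2 ^ k)}

/-- Conditions (h1)–(h3) on `I₀` with respect to the dyadic intervals:
(h1) `0 ≤ h 1 ≤ h 2 ≤ ⋯` and `h m x → ∞` on `I₀`; (h2)–(h3) there are `C > 0` and, for
each `m`, dyadic intervals with pairwise disjoint interiors and union `I₀`, on (the
interior of) each of which `sup h m ≤ C · inf h m`, and whose integrals of `h m` are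
bounded below by a positive constant.  (The sup/inf in (h2) is taken over the interior of
each piece, i.e. disregarding the common endpoints of adjacent pieces, which form a set of
measure zero.) -/
def HCondsDyadic (I0 : Set ℝ) (h : ℕ → ℝ → ℝ) : Prop :=
  (∀ x ∈ I0, (∀ m, 0 ≤ h m x) ∧ (Monotone fun m => h m x) ∧
      Tendsto (fun m => h m x) atTop atTop) ∧
  ∃ C > (0 : ℝ), ∃ ε > (0 : ℝ), ∀ m : ℕ, ∃ (s : ℕ) (J : Fin s → Set ℝ),
    (∀ i, J i ∈ dyadicSet) ∧
    (∀ i j, i ≠ j → Disjoint (interior (J i)) (interior (J j))) ∧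
    (⋃ i, J i) = I0 ∧
    (∀ i, ∀ x ∈ interior (J i), ∀ y ∈ interior (J i), h m x ≤ C * h m y) ∧
    (∀ i, ε ≤ ∫ x in J i, h m x)

theorem ksq_succ (n : ℕ) : ksq (n + 1) = ksq n + n := Nat.triangle_succ n

theorem le_ksq_add_one (n : ℕ) : n ≤ ksq n + 1 := by
  cases n with
  | zero => omega
  | succ n => rw [ksq_succ]; omega

theorem one_sub_one_div_two_pow_mono : Monotone fun i : ℕ => (1 : ℝ) - 1 / 2 ^ i := by
  intro i j hij
  have : (1 : ℝ) / 2 ^ j ≤ 1 / 2 ^ i :=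
    one_div_le_one_div_of_le (by positivity) (pow_le_pow_right₀ one_le_two hij)
  exact sub_le_sub_left this 1

theorem hfun_of_le {n : ℕ} {x : ℝ} (hx : 1 - 1 / 2 ^ n ≤ x) : hfun n x = 2 ^ n :=
  if_pos hx

theorem hfun_of_mem {n i : ℕ} {x : ℝ} (hi : i < n) (h1 : 1 - 1 / 2 ^ i ≤ x)
    (h2 : x < 1 - 1 / 2 ^ (i + 1)) : hfun n x = 2 ^ (ksq n + i + 2) := by
  have hn : ¬ (1 : ℝ) - 1 / 2 ^ n ≤ x :=
    not_le.2 (h2.trans_le (one_sub_one_div_two_pow_mono hi))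
  rw [hfun, if_neg hn, Finset.sum_eq_single (i + 1)]
  · rw [if_pos ⟨by simpa using h1, h2⟩]
    ring
  · intro j hj hji
    refine if_neg fun ⟨h3, h4⟩ => ?_
    rcases lt_or_gt_of_ne hji with h | h
    · have := one_sub_one_div_two_pow_mono (Nat.lt_succ_iff.1 h)
      simp only at this
      linarith
    · have := one_sub_one_div_two_pow_mono (Nat.le_sub_one_of_lt h)
      simp only at this
      linarith
  · intro h
    exact absurd (Finset.mem_Icc.2 ⟨by omega, hi⟩) h

theorem exists_dyadic_piece {n : ℕ} {x : ℝ} (h0 : 0 ≤ x) (hx : x < 1 - 1 / 2 ^ n) :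
    ∃ i < n, 1 - 1 / 2 ^ i ≤ x ∧ x < 1 - 1 / 2 ^ (i + 1) := by
  induction n with
  | zero => norm_num at hx; linarith
  | succ n ih =>
    rcases lt_or_ge x (1 - 1 / 2 ^ n) with h | h
    · obtain ⟨i, hi, h'⟩ := ih h
      exact ⟨i, hi.trans n.lt_succ_self, h'⟩
    · exact ⟨n, n.lt_succ_self, h, hx⟩

theorem two_pow_le_hfun (n : ℕ) {x : ℝ} (h0 : 0 ≤ x) : 2 ^ n ≤ hfun n x := by
  rcases le_or_gt (1 - 1 / 2 ^ n) x with h | h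
  · exact (hfun_of_le h).ge
  · obtain ⟨i, hi, h1, h2⟩ := exists_dyadic_piece h0 h
    rw [hfun_of_mem hi h1 h2]
    have := le_ksq_add_one n
    exact pow_le_pow_right₀ one_le_two (by omega)

theorem hfun_monotone {x : ℝ} (h0 : 0 ≤ x) : Monotone fun n => hfun n x := by
  refine monotone_nat_of_le_succ fun n => ?_
  rcases le_or_gt (1 - 1 / 2 ^ n) x with h | h
  · rw [hfun_of_le h]
    exact (pow_le_pow_right₀ one_le_two n.le_succ).trans (two_pow_le_hfun (n + 1) h0)
  · obtain ⟨i, hi, h1, h2⟩ := exists_dyadic_piece h0 h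
    rw [hfun_of_mem hi h1 h2, hfun_of_mem (hi.trans n.lt_succ_self) h1 h2, ksq_succ]
    exact pow_le_pow_right₀ one_le_two (by omega)

/-- The right endpoint of the `i`-th interval of constancy of `hfun n`. -/
def pieceRight (n i : ℕ) : ℝ := if i < n then 1 - 1 / 2 ^ (i + 1) else 1

/-- The `i`-th closed interval of constancy of `hfun n`, for `i ≤ n`. -/
def piece (n i : ℕ) : Set ℝ := Set.Icc (1 - 1 / 2 ^ i) (pieceRight n i)

theorem pieceRight_le_one (n i : ℕ) : pieceRight n i ≤ 1 := by
  unfold pieceRight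
  split_ifs
  · simp
  · rfl

theorem piece_mem_dyadicSet {n i : ℕ} (hi : i ≤ n) : piece n i ∈ dyadicSet := by
  rcases hi.lt_or_eq with h | rfl
  · refine ⟨i + 1, 2 ^ (i + 1) - 2, ?_⟩
    rw [piece, pieceRight, if_pos h]
    congr 1 <;> push_cast <;> field_simp <;> ring
  · refine ⟨i, 2 ^ i - 1, ?_⟩
    rw [piece, pieceRight, if_neg (lt_irrefl _)]
    congr 1 <;> push_cast <;> field_simp
    ring

theorem disjoint_interior_piece {n i j : ℕ} (hij : i < j) (hj : j ≤ n) :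
    Disjoint (interior (piece n i)) (interior (piece n j)) := by
  simp only [piece, interior_Icc]
  rw [Set.disjoint_left]
  intro x hx hy
  have h := hx.2
  rw [pieceRight, if_pos (hij.trans_le hj)] at h
  exact absurd (h.trans_le (one_sub_one_div_two_pow_mono hij)) hy.1.le.not_gt

theorem iUnion_piece (n : ℕ) : ⋃ i : Fin (n + 1), piece n i = Set.Icc 0 1 := by
  ext x
  rw [Set.mem_iUnion]
  constructor
  · rintro ⟨i, h1, h2⟩
    have := one_sub_one_div_two_pow_mono (Nat.zero_le i)
    norm_num at this h1
    exact ⟨by linarith, h2.trans (pieceRight_le_one n i)⟩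
  · rintro ⟨h0, h1⟩
    rcases le_or_gt (1 - 1 / 2 ^ n) x with h | h
    · exact ⟨Fin.last n, by simpa [piece, pieceRight] using ⟨by simpa using h, h1⟩⟩
    · obtain ⟨i, hi, h2, h3⟩ := exists_dyadic_piece h0 h
      refine ⟨⟨i, hi.trans n.lt_succ_self⟩, h2, ?_⟩
      rw [pieceRight, if_pos hi]
      exact h3.le

/-- The value of `hfun n` on the interior of its `i`-th interval of constancy. -/
def pieceValue (n i : ℕ) : ℝ := if i < n then 2 ^ (ksq n + i + 2) else 2 ^ n

theorem hfun_eq_pieceValue {n i : ℕ} (hi : i ≤ n) {x : ℝ}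
    (hx : x ∈ Set.Ioo (1 - 1 / 2 ^ i) (pieceRight n i)) : hfun n x = pieceValue n i := by
  rcases hi.lt_or_eq with h | rfl
  · have h2 := hx.2
    rw [pieceRight, if_pos h] at h2
    rw [pieceValue, if_pos h, hfun_of_mem h hx.1.le h2]
  · rw [pieceValue, if_neg (lt_irrefl _), hfun_of_le hx.1.le]

theorem one_le_integral_piece {n i : ℕ} (hi : i ≤ n) : 1 ≤ ∫ x in piece n i, hfun n x := by
  rw [piece, integral_Icc_eq_integral_Ioo,
    setIntegral_congr_fun measurableSet_Ioo fun x hx => hfun_eq_pieceValue hi hx,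
    setIntegral_const, smul_eq_mul]
  rcases hi.lt_or_eq with h | rfl
  · have hlen : (1 : ℝ) - 1 / 2 ^ (i + 1) - (1 - 1 / 2 ^ i) = 1 / 2 ^ (i + 1) := by
      field_simp
      ring
    rw [pieceRight, pieceValue, if_pos h, if_pos h, Real.volume_real_Ioo, hlen,
      max_eq_left (by positivity), one_div_mul_eq_div, one_le_div (by positivity)]
    exact pow_le_pow_right₀ one_le_two (by omega)
  · rw [pieceRight, pieceValue, if_neg (lt_irrefl _), if_neg (lt_irrefl _),
      Real.volume_real_Ioo, sub_sub_cancel, max_eq_left (by positivity),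
      one_div_mul_cancel (by positivity)]

/-- **Example.**  The sequence `h_n`, `n ≥ 1`, satisfies conditions (h1)–(h3) on
`I₀ = [0,1]` with respect to the dyadic intervals. -/
theorem hfun_satisfies_HConds :
    HCondsDyadic (Set.Icc (0 : ℝ) 1) (fun n => hfun (n + 1)) := by
  refine ⟨fun x hx => ⟨fun m => ?_, ?_, ?_⟩, 1, one_pos, 1, one_pos, fun m =>
    ⟨m + 1 + 1, fun i => piece (m + 1) i, fun i => ?_, fun i j hij => ?_, iUnion_piece _,
      fun i x hx y hy => ?_, fun i => one_le_integral_piece (Nat.lt_succ_iff.1 i.2)⟩⟩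
  · exact le_trans (by positivity) (two_pow_le_hfun (m + 1) hx.1)
  · exact fun a b hab => hfun_monotone hx.1 (Nat.succ_le_succ hab)
  · exact tendsto_atTop_mono (fun n => two_pow_le_hfun (n + 1) hx.1)
      ((tendsto_pow_atTop_atTop_of_one_lt one_lt_two).comp (tendsto_add_atTop_nat 1))
  · exact piece_mem_dyadicSet (Nat.lt_succ_iff.1 i.2)
  · rcases lt_or_gt_of_ne hij with h | h
    · exact disjoint_interior_piece h (Nat.lt_succ_iff.1 j.2)
    · exact (disjoint_interior_piece h (Nat.lt_succ_iff.1 i.2)).symm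
  · simp only [piece, interior_Icc] at hx hy
    have hi := Nat.lt_succ_iff.1 i.2
    simp only [hfun_eq_pieceValue hi hx, hfun_eq_pieceValue hi hy, one_mul, le_refl]
end
end

section
/- Let $k_n = n(n-1)/2$ and $\alpha(n,i) = (1-2^{-(i-1)})2^{k_n+i}+1$. Then for every $m \in \mathbb N$, every $j$ with $1 \le j \le m$, and every $x \in [1-2^{-(j-1)}, 1-2^{-j})$, one has $\sum_{n=1}^m \sum_{i=1}^n \left| 2^{(k_n+i)/2} \chi_{k_n+i}^{(\alpha(n,i))}(x) \right| \le 2^{k_m+j+1}$. -/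
open MeasureTheory Filter Topology

noncomputable section

/-- `α(n,i) = (1 - 2^{-(i-1)}) 2^{k_n+i} + 1 = 2^{k_n+i} - 2^{k_n+1} + 1`. -/
def alph (n i : ℕ) : ℕ := 2 ^ (ksq n + i) - 2 ^ (ksq n + 1) + 1

/-- The Haar function `χ_k^{(i)}` (two-index notation, `n = 2^k + i`, `1 ≤ i ≤ 2^k`):
`2^{k/2}` on `((i-1)/2^k, (2i-1)/2^{k+1})`, `-2^{k/2}` on `((2i-1)/2^{k+1}, i/2^k)`, `0`
outside `[(i-1)/2^k, i/2^k]` (values at the finitely many break points are immaterial). -/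
def haar (k i : ℕ) (x : ℝ) : ℝ :=
  if ((i : ℝ) - 1) / 2 ^ k < x ∧ x < (2 * (i : ℝ) - 1) / 2 ^ (k + 1) then
    (2 : ℝ) ^ ((k : ℝ) / 2)
  else if (2 * (i : ℝ) - 1) / 2 ^ (k + 1) < x ∧ x < (i : ℝ) / 2 ^ k then
    -((2 : ℝ) ^ ((k : ℝ) / 2))
  else 0

/-- The `N`-th partial sum `∑_{n ≤ N} a_n χ_n(x)` (single-index enumeration) of the Haar
series `∑_{n=1}^∞ ∑_{i=1}^n 2^{(k_n+i)/2} χ_{k_n+i}^{(α(n,i))}`: its terms are the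
functions `2^{(k_n+i)/2} χ_{k_n+i}^{(α(n,i))}` with single index `2^{k_n+i} + α(n,i)`, and
all other coefficients vanish.  (Terms with outer index `n > N` have single index
`≥ 2^{k_n+1} + 1 > N`, so the outer cut-off at `N` loses nothing.) -/
def pSum (N : ℕ) (x : ℝ) : ℝ :=
  ∑ n ∈ Finset.Icc 1 N, ∑ i ∈ Finset.Icc 1 n,
    if 2 ^ (ksq n + i) + alph n i ≤ N then
      (2 : ℝ) ^ ((ksq n + i : ℝ) / 2) * haar (ksq n + i) (alph n i) x
    else 0

theorem sum_two_pow_ksq_le (m : ℕ) (hm : 1 ≤ m) :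
    ∑ n ∈ Finset.Icc 1 m, (2 : ℝ) ^ ksq n ≤ 2 ^ (ksq m + 1) := by
  induction m, hm using Nat.le_induction with
  | base => norm_num [ksq]
  | succ m hm ih =>
    rw [Finset.sum_Icc_succ_top (by omega)]
    have h : (2 : ℝ) ^ (ksq m + 1) ≤ 2 ^ ksq (m + 1) :=
      pow_le_pow_right₀ (by norm_num) (by rw [ksq_succ]; omega)
    rw [pow_succ 2 (ksq (m + 1))]
    linarith

theorem abs_haar_le (k i : ℕ) (x : ℝ) : |haar k i x| ≤ (2 : ℝ) ^ ((k : ℝ) / 2) := by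
  have h : (0 : ℝ) < (2 : ℝ) ^ ((k : ℝ) / 2) := by positivity
  unfold haar
  split_ifs
  · rw [abs_of_pos h]
  · rw [abs_neg, abs_of_pos h]
  · simpa using h.le

theorem mem_Ioo_of_haar_ne_zero {k i : ℕ} {x : ℝ} (h : haar k i x ≠ 0) :
    x ∈ Set.Ioo (((i : ℝ) - 1) / 2 ^ k) ((i : ℝ) / 2 ^ k) := by
  have hk : (0 : ℝ) < 2 ^ k := by positivity
  have hl : ((i : ℝ) - 1) / 2 ^ k < (2 * (i : ℝ) - 1) / 2 ^ (k + 1) := by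
    rw [pow_succ, div_lt_div_iff₀ hk (by positivity)]
    nlinarith
  have hr : (2 * (i : ℝ) - 1) / 2 ^ (k + 1) < (i : ℝ) / 2 ^ k := by
    rw [pow_succ, div_lt_div_iff₀ (by positivity) hk]
    nlinarith
  unfold haar at h
  split_ifs at h with h₁ h₂
  · exact ⟨h₁.1, h₁.2.trans hr⟩
  · exact ⟨hl.trans h₂.1, h₂.2⟩
  · exact absurd rfl h

theorem cast_alph (n i : ℕ) (hi : 1 ≤ i) :
    (alph n i : ℝ) = 2 ^ (ksq n + i) - 2 ^ (ksq n + 1) + 1 := by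
  have h : 2 ^ (ksq n + 1) ≤ 2 ^ (ksq n + i) := Nat.pow_le_pow_right (by norm_num) (by omega)
  unfold alph
  push_cast [Nat.cast_sub h]
  rfl

theorem mem_Ioo_of_haar_alph_ne_zero {n i : ℕ} {x : ℝ} (hi : 1 ≤ i)
    (h : haar (ksq n + i) (alph n i) x ≠ 0) :
    x ∈ Set.Ioo (1 - 1 / 2 ^ (i - 1) : ℝ) (1 - 1 / 2 ^ i) := by
  obtain ⟨h₁, h₂⟩ := mem_Ioo_of_haar_ne_zero h
  rw [cast_alph n i hi] at h₁ h₂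
  obtain ⟨l, rfl⟩ := Nat.exists_eq_add_of_le' hi
  have hk : (1 : ℝ) ≤ 2 ^ ksq n := one_le_pow₀ (by norm_num)
  have hl : (0 : ℝ) < 2 ^ l := by positivity
  simp only [Nat.add_sub_cancel, pow_add, pow_one] at h₁ h₂ ⊢
  constructor
  · refine lt_of_eq_of_lt ?_ h₁
    field_simp
    ring
  · refine h₂.trans_le ?_
    rw [div_le_iff₀ (by positivity)]
    field_simp
    nlinarith

theorem haar_alph_eq_zero {n i j : ℕ} {x : ℝ} (hi : 1 ≤ i) (hij : i ≠ j)
    (hx : x ∈ Set.Ico (1 - 1 / 2 ^ (j - 1) : ℝ) (1 - 1 / 2 ^ j)) :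
    haar (ksq n + i) (alph n i) x = 0 := by
  by_contra h
  obtain ⟨h₁, h₂⟩ := mem_Ioo_of_haar_alph_ne_zero hi h
  obtain ⟨h₃, h₄⟩ := hx
  rcases Nat.lt_or_gt_of_ne hij with hlt | hlt
  · have : (1 : ℝ) / 2 ^ (j - 1) ≤ 1 / 2 ^ i :=
      one_div_pow_le_one_div_pow_of_le (by norm_num) (by omega)
    linarith
  · have : (1 : ℝ) / 2 ^ (i - 1) ≤ 1 / 2 ^ j :=
      one_div_pow_le_one_div_pow_of_le (by norm_num) (by omega)
    linarith

theorem abs_two_rpow_mul_haar_le (k i : ℕ) (x : ℝ) :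
    |(2 : ℝ) ^ ((k : ℝ) / 2) * haar k i x| ≤ 2 ^ k := by
  rw [abs_mul, abs_of_pos (by positivity)]
  calc (2 : ℝ) ^ ((k : ℝ) / 2) * |haar k i x|
      ≤ (2 : ℝ) ^ ((k : ℝ) / 2) * (2 : ℝ) ^ ((k : ℝ) / 2) := by
        gcongr
        exact abs_haar_le k i x
    _ = 2 ^ k := by
        rw [← Real.rpow_add (by norm_num), add_halves, Real.rpow_natCast]

/-- **Example (pointwise bound for the sum of moduli).**  For every `m ≥ 1`, every `j`
with `1 ≤ j ≤ m`, and every `x ∈ [1-2^{-(j-1)}, 1-2^{-j})`,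
`∑_{n=1}^m ∑_{i=1}^n |2^{(k_n+i)/2} χ_{k_n+i}^{(α(n,i))}(x)| ≤ 2^{k_m+j+1}`. -/
theorem sum_of_moduli_bound (m j : ℕ) (hm : 1 ≤ m) (hj : 1 ≤ j) (hjm : j ≤ m)
    (x : ℝ) (hx : x ∈ Set.Ico (1 - 1 / 2 ^ (j - 1) : ℝ) (1 - 1 / 2 ^ j)) :
    ∑ n ∈ Finset.Icc 1 m, ∑ i ∈ Finset.Icc 1 n,
      |(2 : ℝ) ^ ((ksq n + i : ℝ) / 2) * haar (ksq n + i) (alph n i) x|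
      ≤ 2 ^ (ksq m + j + 1) := by
  have inner_le (n : ℕ) : ∑ i ∈ Finset.Icc 1 n,
      |(2 : ℝ) ^ ((ksq n + i : ℝ) / 2) * haar (ksq n + i) (alph n i) x| ≤ 2 ^ j * 2 ^ ksq n := by
    have hz : ∀ i ∈ Finset.Icc 1 n, i ≠ j →
        |(2 : ℝ) ^ ((ksq n + i : ℝ) / 2) * haar (ksq n + i) (alph n i) x| = 0 := by
      intro i hi hij
      rw [haar_alph_eq_zero (Finset.mem_Icc.1 hi).1 hij hx, mul_zero, abs_zero]
    by_cases hjn : j ∈ Finset.Icc 1 n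
    · rw [Finset.sum_eq_single_of_mem j hjn hz, ← pow_add, add_comm j]
      simpa only [Nat.cast_add] using abs_two_rpow_mul_haar_le (ksq n + j) (alph n j) x
    · rw [Finset.sum_eq_zero fun i hi => hz i hi (by rintro rfl; exact hjn hi)]
      positivity
  calc _ ≤ ∑ n ∈ Finset.Icc 1 m, (2 : ℝ) ^ j * 2 ^ ksq n := Finset.sum_le_sum fun n _ => inner_le n
    _ = 2 ^ j * ∑ n ∈ Finset.Icc 1 m, (2 : ℝ) ^ ksq n := by rw [Finset.mul_sum]
    _ ≤ 2 ^ j * 2 ^ (ksq m + 1) := by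
        gcongr
        exact sum_two_pow_ksq_le m hm
    _ = 2 ^ (ksq m + j + 1) := by ring
end
end
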